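/- arXiv:2205.04803 — 3 statements merged into one kernel-verified Lean document; each statement's English description precedes it below -/
import Mathlib

section
/- If β ≠ 0, then for every open neighborhood U of Γ̂ in ℝ⁵ and every integer q with 1 ≤ q ≤ 5, the system ẋ₁ = x₂, ẋ₂ = −x₁ + x₁³ − εδx₂ + βu₁, ε̇ = 0, u̇₁ = −ωu₂, u̇₂ = ωu₁ is not (q, 5−q)-integrable in the Bogoyavlenskij sense with real-analytic data on U. (This is the real-analytic consequence of the paper's Proposition 5.2, which asserts real-meromorphic nonintegrability.) -/
open MeasureTheory Filter Topology

/-- Bogoyavlenskij `(q, m)`-integrability with real-analytic data on an open set `U`: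
there are `q` real-analytic vector fields `f₁ = f, …, f_q` on `U`, linearly independent
at almost every point of `U` and pairwise commuting, and `m` real-analytic functions
`F₁, …, F_m` on `U` whose derivatives are linearly independent at almost every point of
`U` and which are first integrals of every `f_j`. -/
def BogoyavlenskijIntegrable {E : Type*} [NormedAddCommGroup E] [NormedSpace ℝ E]
    [MeasureSpace E] (f : E → E) (U : Set E) (q m : ℕ) : Prop :=
  ∃ (fs : Fin q → E → E) (Fs : Fin m → E → ℝ),
    (∀ (h : 0 < q) (x : E), x ∈ U → fs ⟨0, h⟩ x = f x) ∧
    (∀ j, AnalyticOnNhd ℝ (fs j) U) ∧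
    (∀ k, AnalyticOnNhd ℝ (Fs k) U) ∧
    (∀ j k, ∀ x ∈ U, fderiv ℝ (fs k) x (fs j x) - fderiv ℝ (fs j) x (fs k x) = 0) ∧
    (∀ᵐ x ∂(volume.restrict U), LinearIndependent ℝ (fun j => fs j x)) ∧
    (∀ᵐ x ∂(volume.restrict U), LinearIndependent ℝ (fun k => fderiv ℝ (Fs k) x)) ∧
    (∀ k j, ∀ x ∈ U, fderiv ℝ (Fs k) x (fs j x) = 0)

/-- The autonomous vector field on `ℝ⁵` (coordinates `(x₁, x₂, ε, u₁, u₂)`) of the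
periodically forced Duffing oscillator `ẋ₁ = x₂, ẋ₂ = −x₁ + x₁³ − εδx₂ + βu₁,
ε̇ = 0, u̇₁ = −ωu₂, u̇₂ = ωu₁`. -/
noncomputable def duffingField₂ (β δ ω : ℝ) (x : Fin 5 → ℝ) : Fin 5 → ℝ :=
  ![x 1, -x 0 + x 0 ^ 3 - x 2 * δ * x 1 + β * x 3, 0, -(ω * x 4), ω * x 3]

/-- The heteroclinic set `Γ̂ = {(x^h(t), 0, 0, 0) : t ∈ ℝ} ∪ {(−1,0,0,0,0), (1,0,0,0,0)}`
in `ℝ⁵`, where `x^h(t) = (tanh(t/√2), sech²(t/√2)/√2)`. -/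
noncomputable def heteroclinicSet : Set (Fin 5 → ℝ) :=
  Set.range (fun t : ℝ =>
      ![Real.tanh (t / Real.sqrt 2),
        ((Real.cosh (t / Real.sqrt 2))⁻¹) ^ 2 / Real.sqrt 2, 0, 0, 0])
    ∪ {![-1, 0, 0, 0, 0], ![1, 0, 0, 0, 0]}

/-- The weight `p^{iμ} (1 - p)^{-iμ}`, an integrating factor of the scalar equations below. -/
noncomputable def phaseWeight (μ p : ℝ) : ℂ :=
  (p : ℂ) ^ (μ * Complex.I) * (1 - (p : ℂ)) ^ (-(μ * Complex.I))

lemma norm_phaseWeight {μ p : ℝ} (hp : p ∈ Set.Ioo (0 : ℝ) 1) : ‖phaseWeight μ p‖ = 1 := by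
  have h2 : (1 - (p : ℂ)) = ((1 - p : ℝ) : ℂ) := by push_cast; rfl
  rw [phaseWeight, norm_mul, h2, Complex.norm_cpow_eq_rpow_re_of_pos hp.1,
    Complex.norm_cpow_eq_rpow_re_of_pos (sub_pos.2 hp.2)]
  simp

lemma hasDerivAt_phaseWeight {μ p : ℝ} (hp : p ∈ Set.Ioo (0 : ℝ) 1) :
    HasDerivAt (phaseWeight μ)
      (phaseWeight μ p * (μ * Complex.I) / ((p : ℂ) * (1 - p))) p := by
  have h0 : (p : ℂ) ≠ 0 := by exact_mod_cast hp.1.ne'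
  have h1 : (1 - (p : ℂ)) ≠ 0 := by
    have : (1 - p : ℝ) ≠ 0 := (sub_pos.2 hp.2).ne'
    exact_mod_cast this
  have hs0 : (p : ℂ) ∈ Complex.slitPlane := Complex.ofReal_mem_slitPlane.2 hp.1
  have hs1 : (1 - (p : ℂ)) ∈ Complex.slitPlane := by
    have := Complex.ofReal_mem_slitPlane.2 (sub_pos.2 hp.2)
    push_cast at this
    exact this
  have e0 := (hasDerivAt_id (p : ℂ)).cpow_const (c := μ * Complex.I) hs0
  have e1 := ((hasDerivAt_id (p : ℂ)).const_sub 1).cpow_const (c := -(μ * Complex.I)) hs1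
  have e := (e0.mul e1).comp_ofReal
  refine e.congr_deriv ?_
  simp only [phaseWeight, id, Complex.cpow_sub _ _ h0, Complex.cpow_sub _ _ h1, Complex.cpow_one]
  field_simp
  ring

lemma intervalIntegrable_phaseWeight (μ : ℝ) :
    IntervalIntegrable (phaseWeight μ) volume 0 1 := by
  have := Complex.betaIntegral_convergent (u := 1 + μ * Complex.I) (v := 1 - μ * Complex.I)
    (by simp) (by simp)
  convert this using 3 with p
  simp [phaseWeight]

lemma integral_phaseWeight_ne_zero (μ : ℝ) : ∫ p in (0 : ℝ)..1, phaseWeight μ p ≠ 0 := by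
  have hu : 0 < (1 + μ * Complex.I).re := by simp
  have hv : 0 < (1 - μ * Complex.I).re := by simp
  have h := Complex.Gamma_mul_Gamma_eq_betaIntegral hu hv
  have e : Complex.betaIntegral (1 + μ * Complex.I) (1 - μ * Complex.I)
      = ∫ p in (0 : ℝ)..1, phaseWeight μ p := by
    simp [Complex.betaIntegral, phaseWeight]
  intro h0
  rw [e, h0, mul_zero] at h
  exact mul_ne_zero (Complex.Gamma_ne_zero_of_re_pos hu) (Complex.Gamma_ne_zero_of_re_pos hv) h

/-- A function vanishing at an end of the interval still does so after multiplication by the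
weight. -/
lemma tendsto_mul_phaseWeight {μ : ℝ} {h : ℝ → ℂ} {l : Filter ℝ}
    (hl : ∀ᶠ p in l, p ∈ Set.Ioo (0 : ℝ) 1) (hh : Tendsto h l (𝓝 0)) :
    Tendsto (fun p => h p * phaseWeight μ p) l (𝓝 0) := by
  rw [tendsto_zero_iff_norm_tendsto_zero] at hh ⊢
  refine hh.congr' ?_
  filter_upwards [hl] with p hp
  rw [norm_mul, norm_phaseWeight hp, mul_one]

lemma hasDerivAt_mul_phaseWeight {μ : ℝ} {h : ℝ → ℂ} {h' ρ : ℂ} {p : ℝ}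
    (hp : p ∈ Set.Ioo (0 : ℝ) 1) (hd : HasDerivAt h h' p)
    (heq : (p : ℂ) * (1 - p) * h' + μ * Complex.I * h p = p * (1 - p) * ρ) :
    HasDerivAt (fun p => h p * phaseWeight μ p) (ρ * phaseWeight μ p) p := by
  have h0 : (p : ℂ) ≠ 0 := by exact_mod_cast hp.1.ne'
  have h1 : (1 - (p : ℂ)) ≠ 0 := by
    have : (1 - p : ℝ) ≠ 0 := (sub_pos.2 hp.2).ne'
    exact_mod_cast this
  refine (hd.mul (hasDerivAt_phaseWeight hp)).congr_deriv ?_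
  field_simp
  linear_combination phaseWeight μ p * heq

lemma eventually_Ioo_right {p : ℝ} (hp : p ∈ Set.Ioc (0 : ℝ) 1) :
    ∀ᶠ x in 𝓝[<] p, x ∈ Set.Ioo (0 : ℝ) 1 :=
  mem_of_superset (Ioo_mem_nhdsLT hp.1) (Set.Ioo_subset_Ioo_right hp.2)

lemma eventually_Ioo_left : ∀ᶠ x in 𝓝[>] (0 : ℝ), x ∈ Set.Ioo (0 : ℝ) 1 :=
  Ioo_mem_nhdsGT one_pos

lemma integral_mul_phaseWeight_eq_zero {μ : ℝ} {h ρ : ℝ → ℂ}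
    (h0 : Tendsto h (𝓝[>] 0) (𝓝 0)) (h1 : Tendsto h (𝓝[<] 1) (𝓝 0)) (hρ : Continuous ρ)
    (heq : ∀ p ∈ Set.Ioo (0 : ℝ) 1, ∃ h', HasDerivAt h h' p ∧
      (p : ℂ) * (1 - p) * h' + μ * Complex.I * h p = p * (1 - p) * ρ p) :
    ∫ p in (0 : ℝ)..1, ρ p * phaseWeight μ p = 0 := by
  have hd : ∀ p ∈ Set.Ioo (0 : ℝ) 1,
      HasDerivAt (fun p => h p * phaseWeight μ p) (ρ p * phaseWeight μ p) p := by
    intro p hp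
    obtain ⟨h', hd, he⟩ := heq p hp
    exact hasDerivAt_mul_phaseWeight hp hd he
  have hI : IntervalIntegrable (fun p => ρ p * phaseWeight μ p) volume 0 1 :=
    (intervalIntegrable_phaseWeight μ).continuousOn_mul hρ.continuousOn
  rw [intervalIntegral.integral_eq_sub_of_hasDerivAt_of_tendsto one_pos hd hI
    (tendsto_mul_phaseWeight eventually_Ioo_left h0)
    (tendsto_mul_phaseWeight (eventually_Ioo_right ⟨one_pos, le_rfl⟩) h1), sub_zero]

lemma eq_zero_of_homogeneous {μ : ℝ} {h : ℝ → ℂ} (h0 : Tendsto h (𝓝[>] 0) (𝓝 0))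
    (heq : ∀ p ∈ Set.Ioo (0 : ℝ) 1, ∃ h', HasDerivAt h h' p ∧
      (p : ℂ) * (1 - p) * h' + μ * Complex.I * h p = 0) :
    ∀ p ∈ Set.Ioo (0 : ℝ) 1, h p = 0 := by
  have hd : ∀ p ∈ Set.Ioo (0 : ℝ) 1, HasDerivAt (fun p => h p * phaseWeight μ p) 0 p := by
    intro p hp
    obtain ⟨h', hd, he⟩ := heq p hp
    simpa using hasDerivAt_mul_phaseWeight (ρ := 0) hp hd (by simpa using he)
  intro p hp
  have hlim : Tendsto (fun p => h p * phaseWeight μ p) (𝓝[<] p) (𝓝 (h p * phaseWeight μ p)) :=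
    (hd p hp).continuousAt.tendsto.mono_left nhdsWithin_le_nhds
  have := intervalIntegral.integral_eq_sub_of_hasDerivAt_of_tendsto (f' := fun _ => (0 : ℂ)) hp.1
    (fun x hx => hd x ⟨hx.1, hx.2.trans hp.2⟩) (by simp)
    (tendsto_mul_phaseWeight eventually_Ioo_left h0) hlim
  have hz : h p * phaseWeight μ p = 0 := by simpa using this.symm
  refine (mul_eq_zero.1 hz).resolve_right fun hw => ?_
  have := norm_phaseWeight (μ := μ) hp
  simp [hw] at this

/-- The moments of order zero and one of the weight are related by integration by parts. -/
lemma coeff_relation_of_integral {μ : ℝ} {h : ℝ → ℂ} {κ₀ κ₁ : ℂ}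
    (h0 : Tendsto h (𝓝[>] 0) (𝓝 0)) (h1 : Tendsto h (𝓝[<] 1) (𝓝 0))
    (heq : ∀ p ∈ Set.Ioo (0 : ℝ) 1, ∃ h', HasDerivAt h h' p ∧
      (p : ℂ) * (1 - p) * h' + μ * Complex.I * h p = p * (1 - p) * (κ₀ + κ₁ * (2 * p - 1))) :
    κ₀ + κ₁ * (μ * Complex.I) = 0 := by
  have hlim : ∀ (x : ℝ) (l : Filter ℝ), (l ≤ 𝓝 x) → x * (1 - x) = 0 →
      Tendsto (fun p : ℝ => κ₁ * ((p : ℂ) * (1 - p))) l (𝓝 0) := by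
    intro x l hl hx
    have hc : Continuous (fun p : ℝ => κ₁ * ((p : ℂ) * (1 - p))) := by fun_prop
    have := (hc.tendsto x).mono_left hl
    have e : κ₁ * ((x : ℂ) * (1 - x)) = 0 := by
      have : ((x * (1 - x) : ℝ) : ℂ) = 0 := by rw [hx]; simp
      push_cast at this
      rw [this, mul_zero]
    rwa [e] at this
  have key := integral_mul_phaseWeight_eq_zero (μ := μ)
    (h := fun p => h p + κ₁ * ((p : ℂ) * (1 - p)))
    (ρ := fun _ => κ₀ + κ₁ * (μ * Complex.I))
    (by simpa using h0.add (hlim 0 _ nhdsWithin_le_nhds (by simp)))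
    (by simpa using h1.add (hlim 1 _ nhdsWithin_le_nhds (by simp))) continuous_const (by
      intro p hp
      obtain ⟨h', hd, he⟩ := heq p hp
      have e0 := (((hasDerivAt_id (p : ℂ)).mul ((hasDerivAt_id (p : ℂ)).const_sub 1)).const_mul
        κ₁).comp_ofReal
      refine ⟨_, hd.add e0, ?_⟩
      simp only [id]
      linear_combination he)
  rw [intervalIntegral.integral_const_mul] at key
  exact (mul_eq_zero.1 key).resolve_right (integral_phaseWeight_ne_zero μ)

lemma AnalyticAt.dslope {f : ℝ → ℂ} {a b : ℝ} (ha : AnalyticAt ℝ f a) (hb : AnalyticAt ℝ f b) :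
    AnalyticAt ℝ (dslope f a) b := by
  rcases eq_or_ne b a with rfl | hne
  · obtain ⟨q, hq⟩ := ha
    exact ⟨_, hq.has_fpower_series_dslope_fslope⟩
  · have : (fun x => (x - a)⁻¹ • (f x - f a)) =ᶠ[𝓝 b] _root_.dslope f a := by
      filter_upwards [isOpen_ne.mem_nhds hne] with x hx
      rw [dslope_of_ne _ hx, slope_def_module]
    refine AnalyticAt.congr ?_ this
    exact ((analyticAt_id.sub analyticAt_const).inv (sub_ne_zero.2 hne)).smul
      (hb.sub analyticAt_const)

lemma exists_eq_mul_of_vanish_ends {h : ℝ → ℂ} (ha : AnalyticOnNhd ℝ h (Set.Icc 0 1))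
    (h0 : h 0 = 0) (h1 : h 1 = 0) :
    ∃ g : ℝ → ℂ, AnalyticOnNhd ℝ g (Set.Icc 0 1) ∧ ∀ p : ℝ, h p = p * (1 - p) * g p := by
  have m0 : (0 : ℝ) ∈ Set.Icc (0 : ℝ) 1 := by simp
  have m1 : (1 : ℝ) ∈ Set.Icc (0 : ℝ) 1 := by simp
  have hd0 : ∀ x ∈ Set.Icc (0 : ℝ) 1, AnalyticAt ℝ (dslope h 0) x :=
    fun x hx => (ha 0 m0).dslope (ha x hx)
  refine ⟨fun p => -dslope (dslope h 0) 1 p, fun x hx => ((hd0 1 m1).dslope (hd0 x hx)).neg, ?_⟩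
  intro p
  have e1 := sub_smul_dslope h 0 p
  have e2 := sub_smul_dslope h 0 1
  have e3 := sub_smul_dslope (dslope h 0) 1 p
  simp only [Complex.real_smul, h0, h1] at e1 e2 e3
  push_cast at e1 e2 e3
  linear_combination -e1 - p * e3 + p * e2

lemma hasDerivAt_of_analyticOnNhd {h : ℝ → ℂ} (ha : AnalyticOnNhd ℝ h (Set.Icc 0 1)) {p : ℝ}
    (hp : p ∈ Set.Ioo (0 : ℝ) 1) : HasDerivAt h (deriv h p) p :=
  (ha p (Set.Ioo_subset_Icc_self hp)).differentiableAt.hasDerivAt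

lemma tendsto_ends {h : ℝ → ℂ} (ha : AnalyticOnNhd ℝ h (Set.Icc 0 1)) (h0 : h 0 = 0)
    (h1 : h 1 = 0) : Tendsto h (𝓝[>] 0) (𝓝 0) ∧ Tendsto h (𝓝[<] 1) (𝓝 0) := by
  have c0 := (ha 0 (by simp)).continuousAt.tendsto
  have c1 := (ha 1 (by simp)).continuousAt.tendsto
  rw [h0] at c0
  rw [h1] at c1
  exact ⟨c0.mono_left nhdsWithin_le_nhds, c1.mono_left nhdsWithin_le_nhds⟩

lemma ofReal_mul_one_sub_ne_zero {p : ℝ} (hp : p ∈ Set.Ioo (0 : ℝ) 1) :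
    (p : ℂ) * (1 - p) ≠ 0 := by
  have : (p * (1 - p) : ℝ) ≠ 0 := (mul_pos hp.1 (sub_pos.2 hp.2)).ne'
  exact_mod_cast this

/-- The equation forces solutions that are analytic up to the ends to vanish there. -/
lemma vanish_ends {n : ℕ} {μ : ℝ} {h ρ : ℝ → ℂ} (ha : AnalyticOnNhd ℝ h (Set.Icc 0 1))
    (hρ : Continuous ρ) (hn : n ≠ 0 ∨ μ ≠ 0)
    (heq : ∀ p ∈ Set.Ioo (0 : ℝ) 1, (p : ℂ) * (1 - p) * deriv h p
      + ((2 * p - 1) * n + μ * Complex.I) * h p = (p * (1 - p)) ^ (n + 1) * ρ p) :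
    h 0 = 0 ∧ h 1 = 0 := by
  have c0 : ContinuousOn h (Set.Icc 0 1) := ha.continuousOn
  have c1 : ContinuousOn (deriv h) (Set.Icc 0 1) := ha.deriv.continuousOn
  have hcl : Set.EqOn (fun p : ℝ => (p : ℂ) * (1 - p) * deriv h p
      + ((2 * p - 1) * n + μ * Complex.I) * h p) (fun p : ℝ => ((p : ℂ) * (1 - p)) ^ (n + 1) * ρ p)
      (Set.Icc 0 1) := by
    refine Set.EqOn.of_subset_closure heq ?_ ?_ Set.Ioo_subset_Icc_self ?_
    · fun_prop
    · fun_prop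
    · rw [closure_Ioo (by norm_num)]
  have z0 := hcl (show (0 : ℝ) ∈ Set.Icc (0 : ℝ) 1 by simp)
  have z1 := hcl (show (1 : ℝ) ∈ Set.Icc (0 : ℝ) 1 by simp)
  simp only [Complex.ofReal_zero, zero_mul, zero_add, mul_zero, zero_sub, Complex.ofReal_one,
    sub_self, mul_one, ne_eq, Nat.succ_ne_zero, not_false_eq_true, zero_pow, mul_eq_zero] at z0 z1
  have hne : ∀ σ : ℝ, σ ≠ 0 → (σ : ℂ) * n + μ * Complex.I ≠ 0 := by
    intro σ hσ h
    have hr := congrArg Complex.re h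
    have hi := congrArg Complex.im h
    simp at hr hi
    rcases hn with hn | hn
    · exact hr.elim hσ hn
    · exact hn hi
  constructor
  · refine z0.resolve_left ?_
    have := hne (-1) (by norm_num)
    simpa using this
  · refine z1.resolve_left ?_
    have := hne 1 (by norm_num)
    norm_num at this ⊢
    exact this

/-- Division of an analytic solution by the largest possible power of `p (1 - p)`. -/
lemma exists_reduced_solution {n : ℕ} {μ : ℝ} {h ρ : ℝ → ℂ}
    (ha : AnalyticOnNhd ℝ h (Set.Icc 0 1)) (hρ : Continuous ρ)
    (heq : ∀ p ∈ Set.Ioo (0 : ℝ) 1, (p : ℂ) * (1 - p) * deriv h p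
      + ((2 * p - 1) * n + μ * Complex.I) * h p = (p * (1 - p)) ^ (n + 1) * ρ p) :
    ∃ g : ℝ → ℂ, AnalyticOnNhd ℝ g (Set.Icc 0 1) ∧
      (∀ p : ℝ, h p = ((p : ℂ) * (1 - p)) ^ n * g p) ∧
      ∀ p ∈ Set.Ioo (0 : ℝ) 1, (p : ℂ) * (1 - p) * deriv g p + μ * Complex.I * g p
        = p * (1 - p) * ρ p := by
  induction n generalizing h with
  | zero => exact ⟨h, ha, by simp, fun p hp => by simpa using heq p hp⟩
  | succ n ih =>
    obtain ⟨h0, h1⟩ := vanish_ends ha hρ (Or.inl n.succ_ne_zero) heq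
    obtain ⟨g, hg, hgh⟩ := exists_eq_mul_of_vanish_ends ha h0 h1
    obtain ⟨k, hk, hgk, hkeq⟩ := ih hg (fun p hp => by
      have e0 := ((hasDerivAt_id (p : ℂ)).mul ((hasDerivAt_id (p : ℂ)).const_sub 1)).comp_ofReal
      have e1 := e0.mul (hasDerivAt_of_analyticOnNhd hg hp)
      have e2 : h = fun p : ℝ => ((p : ℂ) * (1 - p)) * g p := funext hgh
      have e3 : deriv h p = (1 - 2 * p) * g p + p * (1 - p) * deriv g p := by
        rw [e2]
        refine e1.deriv.trans ?_
        simp only [id, Pi.mul_apply]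
        ring
      have := heq p hp
      rw [e3, hgh p] at this
      push_cast at this
      refine mul_left_cancel₀ (ofReal_mul_one_sub_ne_zero hp) ?_
      linear_combination this)
    refine ⟨k, hk, fun p => ?_, hkeq⟩
    rw [hgh, hgk]
    ring

lemma solution_eq_zero {n : ℕ} {μ : ℝ} (hμ : μ ≠ 0) {h : ℝ → ℂ}
    (ha : AnalyticOnNhd ℝ h (Set.Icc 0 1))
    (heq : ∀ p ∈ Set.Ioo (0 : ℝ) 1, (p : ℂ) * (1 - p) * deriv h p
      + ((2 * p - 1) * n + μ * Complex.I) * h p = 0) :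
    ∀ p ∈ Set.Ioo (0 : ℝ) 1, h p = 0 := by
  obtain ⟨g, hg, hgh, hgeq⟩ := exists_reduced_solution (ρ := fun _ => 0) ha continuous_const
    (fun p hp => by simpa using heq p hp)
  obtain ⟨g0, g1⟩ := vanish_ends (n := 0) (ρ := fun _ => 0) hg continuous_const (Or.inr hμ)
    (fun p hp => by simpa using hgeq p hp)
  intro p hp
  rw [hgh, eq_zero_of_homogeneous (μ := μ) (tendsto_ends hg g0 g1).1 (fun p hp =>
    ⟨_, hasDerivAt_of_analyticOnNhd hg hp, by simpa using hgeq p hp⟩) p hp, mul_zero]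

lemma solution_eq_const_mul {n : ℕ} {h : ℝ → ℂ} (ha : AnalyticOnNhd ℝ h (Set.Icc 0 1))
    (heq : ∀ p ∈ Set.Ioo (0 : ℝ) 1, (p : ℂ) * (1 - p) * deriv h p
      + (2 * p - 1) * n * h p = 0) :
    ∃ κ : ℂ, ∀ p ∈ Set.Ioo (0 : ℝ) 1, h p = ((p : ℂ) * (1 - p)) ^ n * κ := by
  obtain ⟨g, hg, hgh, hgeq⟩ := exists_reduced_solution (ρ := fun _ => 0) (μ := 0) ha
    continuous_const (fun p hp => by simpa using heq p hp)
  refine ⟨g (1 / 2), fun p hp => ?_⟩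
  rw [hgh]
  congr 1
  refine isOpen_Ioo.is_const_of_deriv_eq_zero isPreconnected_Ioo
    (fun x hx => (hasDerivAt_of_analyticOnNhd hg hx).differentiableAt.differentiableWithinAt)
    (fun x hx => ?_) hp (by norm_num)
  have := hgeq x hx
  simpa [ofReal_mul_one_sub_ne_zero hx] using this

lemma forcing_eq_zero {n : ℕ} {μ : ℝ} (hμ : μ ≠ 0) {h : ℝ → ℂ} {κ : ℂ}
    (ha : AnalyticOnNhd ℝ h (Set.Icc 0 1))
    (heq : ∀ p ∈ Set.Ioo (0 : ℝ) 1, (p : ℂ) * (1 - p) * deriv h p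
      + ((2 * p - 1) * n + μ * Complex.I) * h p = (p * (1 - p)) ^ (n + 1) * κ) : κ = 0 := by
  obtain ⟨g, hg, hgh, hgeq⟩ := exists_reduced_solution (ρ := fun _ => κ) ha continuous_const heq
  obtain ⟨g0, g1⟩ := vanish_ends (n := 0) (ρ := fun _ => κ) hg continuous_const (Or.inr hμ)
    (fun p hp => by simpa using hgeq p hp)
  obtain ⟨t0, t1⟩ := tendsto_ends hg g0 g1
  simpa using coeff_relation_of_integral (μ := μ) (κ₀ := κ) (κ₁ := 0) t0 t1 (fun p hp =>
    ⟨_, hasDerivAt_of_analyticOnNhd hg hp, by simpa using hgeq p hp⟩)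

lemma exists_deriv_mul_solution {μ : ℝ} {h ρ : ℝ → ℂ} (ha : AnalyticOnNhd ℝ h (Set.Icc 0 1))
    (heq : ∀ p ∈ Set.Ioo (0 : ℝ) 1, (p : ℂ) * (1 - p) * deriv h p
      + (-(2 * p - 1) + μ * Complex.I) * h p = ρ p) :
    ∀ p ∈ Set.Ioo (0 : ℝ) 1, ∃ h', HasDerivAt (fun p : ℝ => (p : ℂ) * (1 - p) * h p) h' p ∧
      (p : ℂ) * (1 - p) * h' + μ * Complex.I * ((p : ℂ) * (1 - p) * h p)
        = p * (1 - p) * ρ p := by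
  intro p hp
  have e0 := ((hasDerivAt_id (p : ℂ)).mul ((hasDerivAt_id (p : ℂ)).const_sub 1)).comp_ofReal
  refine ⟨_, e0.mul (hasDerivAt_of_analyticOnNhd ha hp), ?_⟩
  simp only [id, Pi.mul_apply]
  linear_combination (p : ℂ) * (1 - p) * heq p hp

lemma tendsto_ends_mul {h : ℝ → ℂ} (ha : AnalyticOnNhd ℝ h (Set.Icc 0 1)) :
    Tendsto (fun p : ℝ => (p : ℂ) * (1 - p) * h p) (𝓝[>] 0) (𝓝 0) ∧
      Tendsto (fun p : ℝ => (p : ℂ) * (1 - p) * h p) (𝓝[<] 1) (𝓝 0) := by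
  refine tendsto_ends (fun x hx => ?_) (by simp) (by simp)
  have : AnalyticAt ℝ (fun p : ℝ => (p : ℂ)) x := Complex.ofRealCLM.analyticAt x
  exact (this.mul (analyticAt_const.sub this)).mul (ha x hx)

lemma solution_eq_zero_of_pole {μ : ℝ} {h : ℝ → ℂ} (ha : AnalyticOnNhd ℝ h (Set.Icc 0 1))
    (heq : ∀ p ∈ Set.Ioo (0 : ℝ) 1, (p : ℂ) * (1 - p) * deriv h p
      + (-(2 * p - 1) + μ * Complex.I) * h p = 0) :
    ∀ p ∈ Set.Ioo (0 : ℝ) 1, h p = 0 := by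
  intro p hp
  have := eq_zero_of_homogeneous (μ := μ) (tendsto_ends_mul ha).1 (fun p hp => by
    simpa using exists_deriv_mul_solution (ρ := fun _ => 0) ha heq p hp) p hp
  exact (mul_eq_zero.1 this).resolve_left (ofReal_mul_one_sub_ne_zero hp)

lemma forcing_relation_of_pole {μ : ℝ} {h : ℝ → ℂ} {κ₀ κ₁ : ℂ}
    (ha : AnalyticOnNhd ℝ h (Set.Icc 0 1))
    (heq : ∀ p ∈ Set.Ioo (0 : ℝ) 1, (p : ℂ) * (1 - p) * deriv h p
      + (-(2 * p - 1) + μ * Complex.I) * h p = κ₀ + κ₁ * (2 * p - 1)) :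
    κ₀ + κ₁ * (μ * Complex.I) = 0 :=
  coeff_relation_of_integral (tendsto_ends_mul ha).1 (tendsto_ends_mul ha).2
    (exists_deriv_mul_solution (ρ := fun p : ℝ => κ₀ + κ₁ * (2 * (p : ℂ) - 1)) ha heq)

lemma solution_eq_affine {h : ℝ → ℂ} {κ : ℂ} (ha : AnalyticOnNhd ℝ h (Set.Icc 0 1))
    (heq : ∀ p ∈ Set.Ioo (0 : ℝ) 1,
      (p : ℂ) * (1 - p) * deriv h p = 2 * (p * (1 - p) * κ)) :
    ∃ κ₀ : ℂ, ∀ p ∈ Set.Ioo (0 : ℝ) 1, h p = κ₀ + κ * (2 * p - 1) := by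
  have e0 : ∀ x : ℝ, HasDerivAt (fun p : ℝ => κ * (2 * (p : ℂ) - 1)) (κ * 2) x := fun x => by
    simpa using
      ((((hasDerivAt_id (x : ℂ)).const_mul 2).sub_const 1).const_mul κ).comp_ofReal
  have ha' : AnalyticOnNhd ℝ (fun p : ℝ => h p - κ * (2 * (p : ℂ) - 1)) (Set.Icc 0 1) := by
    intro x hx
    have : AnalyticAt ℝ (fun p : ℝ => (p : ℂ)) x := Complex.ofRealCLM.analyticAt x
    exact (ha x hx).sub (analyticAt_const.mul ((analyticAt_const.mul this).sub analyticAt_const))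
  obtain ⟨κ₀, h₀⟩ := solution_eq_const_mul (n := 0) ha' (fun p hp => by
    rw [((hasDerivAt_of_analyticOnNhd ha hp).fun_sub (e0 p)).deriv]
    push_cast
    linear_combination heq p hp)
  refine ⟨κ₀, fun p hp => ?_⟩
  have := h₀ p hp
  linear_combination this

/-- A triangular family of scalar equations, coupled through the index `j`, has only solutions
supported at `j = 0`, `k = l` among the families analytic up to the ends. -/
lemma family_eq_zero {B : ℕ → ℕ → ℕ → ℝ → ℂ} {M o : ℕ} {ν : ℝ} {b : ℂ} (hν : ν ≠ 0) (hb : b ≠ 0)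
    (ha : ∀ j k l, AnalyticOnNhd ℝ (B j k l) (Set.Icc 0 1))
    (heq : ∀ j k l, j + k + l = M → (1 ≤ j ∨ k ≠ l) → ∀ p ∈ Set.Ioo (0 : ℝ) 1,
      (p : ℂ) * (1 - p) * deriv (B j k l) p
        + ((2 * p - 1) * (j + o : ℕ) + (ν * (k - l) : ℝ) * Complex.I) * B j k l p
        + b * (k * B (j + 1) (k - 1) l p + l * B (j + 1) k (l - 1) p) = 0)
    (j k l : ℕ) (hM : j + k + l = M) (hjkl : 1 ≤ j ∨ k ≠ l) :
    ∀ p ∈ Set.Ioo (0 : ℝ) 1, B j k l p = 0 := by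
  induction hi : k + l using Nat.strong_induction_on generalizing j k l with
  | _ i ih =>
  have coupling : ∀ j k l, j + k + l = M → k + l = i → ∀ p ∈ Set.Ioo (0 : ℝ) 1,
      (k : ℂ) * B (j + 1) (k - 1) l p + l * B (j + 1) k (l - 1) p = 0 := by
    intro j k l hM hi p hp
    have h1 : (k : ℂ) * B (j + 1) (k - 1) l p = 0 := by
      rcases Nat.eq_zero_or_pos k with rfl | hk
      · simp
      · rw [ih (k - 1 + l) (by omega) (j + 1) (k - 1) l (by omega) (by omega) rfl p hp, mul_zero]
    have h2 : (l : ℂ) * B (j + 1) k (l - 1) p = 0 := by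
      rcases Nat.eq_zero_or_pos l with rfl | hk
      · simp
      · rw [ih (k + (l - 1)) (by omega) (j + 1) k (l - 1) (by omega) (by omega) rfl p hp, mul_zero]
    rw [h1, h2, add_zero]
  have offdiag : ∀ j k l, j + k + l = M → k + l = i → k ≠ l → ∀ p ∈ Set.Ioo (0 : ℝ) 1,
      B j k l p = 0 := by
    intro j k l hM hi hkl
    have hμ : ν * ((k : ℝ) - l) ≠ 0 :=
      mul_ne_zero hν (sub_ne_zero.2 (by exact_mod_cast hkl))
    refine solution_eq_zero (n := j + o) hμ (ha j k l) fun p hp => ?_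
    have := heq j k l hM (Or.inr hkl) p hp
    rw [coupling j k l hM hi p hp, mul_zero, add_zero] at this
    exact this
  by_cases hkl : k = l
  swap
  · exact offdiag j k l hM hi hkl
  subst hkl
  have hj : 1 ≤ j := hjkl.resolve_right (by simp)
  obtain ⟨j, rfl⟩ := Nat.exists_eq_add_of_le' hj
  obtain ⟨κ, hκ⟩ := solution_eq_const_mul (n := j + 1 + o) (ha (j + 1) k k) fun p hp => by
    have := heq (j + 1) k k hM hjkl p hp
    rw [coupling _ k k hM hi p hp] at this
    simpa using this
  have hzero : -b * (k + 1) * κ = 0 := by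
    refine forcing_eq_zero (n := j + o) (μ := ν) hν (ha j (k + 1) k) fun p hp => ?_
    have h1 := heq j (k + 1) k (by omega) (Or.inr (by omega)) p hp
    have h2 : (k : ℂ) * B (j + 1) (k + 1) (k - 1) p = 0 := by
      rcases Nat.eq_zero_or_pos k with rfl | hk
      · simp
      · rw [offdiag (j + 1) (k + 1) (k - 1) (by omega) (by omega) (by omega) p hp, mul_zero]
    rw [h2, Nat.add_sub_cancel, hκ p hp] at h1
    push_cast at h1 ⊢
    rw [show j + 1 + o = j + o + 1 by ring] at h1
    linear_combination h1
  have hk : (k : ℂ) + 1 ≠ 0 := by exact_mod_cast k.succ_ne_zero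
  have hκ0 : κ = 0 := by simpa [hb, hk] using hzero
  intro p hp
  rw [hκ p hp, hκ0, mul_zero]

/-- Five commuting derivations with dual coordinates `(p, y, e, z, w)` on an algebra of functions,
together with evaluations along the curve `p = t`, `y = e = z = w = 0`. -/
structure JetCurve (A : Type*) [CommRing A] [Algebra ℂ A] where
  d : Fin 5 → Derivation ℂ A A
  x : Fin 5 → A
  ev : ℝ → A →ₐ[ℂ] ℂ
  comm : ∀ i j φ, d i (d j φ) = d j (d i φ)
  d_x : ∀ i j, d i (x j) = if i = j then 1 else 0
  ev_zero : ∀ t ∈ Set.Ioo (0 : ℝ) 1, ev t (x 0) = t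
  ev_ne_zero : ∀ t ∈ Set.Ioo (0 : ℝ) 1, ∀ i, i ≠ 0 → ev t (x i) = 0
  analytic : ∀ φ, AnalyticOnNhd ℝ (fun t => ev t φ) (Set.Icc 0 1)
  hasDerivAt : ∀ φ, ∀ t ∈ Set.Ioo (0 : ℝ) 1, HasDerivAt (fun t => ev t φ) (ev t (d 0 φ)) t

namespace JetCurve

variable {A : Type*} [CommRing A] [Algebra ℂ A] (S : JetCurve A)

/-- The partial derivative of order `(e, j, k, l)` in the transverse directions. -/
def dpow (e j k l : ℕ) : Module.End ℂ A :=
  (S.d 2 : A →ₗ[ℂ] A) ^ e * (S.d 1 : A →ₗ[ℂ] A) ^ j * (S.d 3 : A →ₗ[ℂ] A) ^ k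
    * (S.d 4 : A →ₗ[ℂ] A) ^ l

/-- Transverse partial derivatives along the curve. -/
def jet (e j k l : ℕ) (φ : A) (t : ℝ) : ℂ := S.ev t (S.dpow e j k l φ)

lemma pow_mul_of_eq_zero {D : Derivation ℂ A A} {u : A} (hu : D u = 0) (n : ℕ) (φ : A) :
    ((D : A →ₗ[ℂ] A) ^ n) (u * φ) = u * ((D : A →ₗ[ℂ] A) ^ n) φ := by
  induction n with
  | zero => simp
  | succ n ih => rw [pow_succ', Module.End.mul_apply, ih, Module.End.mul_apply]; simp [hu]

lemma pow_mul_of_eq_one {D : Derivation ℂ A A} {u : A} (hu : D u = 1) (n : ℕ) (φ : A) :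
    ((D : A →ₗ[ℂ] A) ^ n) (u * φ)
      = u * ((D : A →ₗ[ℂ] A) ^ n) φ + (n : ℂ) • ((D : A →ₗ[ℂ] A) ^ (n - 1)) φ := by
  induction n with
  | zero => simp
  | succ n ih =>
    rw [pow_succ', Module.End.mul_apply, ih, Module.End.mul_apply]
    rcases n with _ | n
    · simp [hu]
    · simp only [Derivation.coeFn_coe, map_add, Derivation.leibniz, hu, smul_eq_mul, mul_one,
        Derivation.map_smul, Nat.add_sub_cancel]
      rw [pow_succ' _ n, Module.End.mul_apply]
      simp only [Derivation.coeFn_coe]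
      push_cast
      module

lemma commute_d (i j : Fin 5) : Commute (S.d i : A →ₗ[ℂ] A) (S.d j : A →ₗ[ℂ] A) := by
  ext φ
  simpa using S.comm i j φ

lemma dpow_d_zero (e j k l : ℕ) (φ : A) :
    S.dpow e j k l (S.d 0 φ) = S.d 0 (S.dpow e j k l φ) := by
  have h : Commute (S.dpow e j k l) (S.d 0 : A →ₗ[ℂ] A) :=
    ((((S.commute_d 2 0).pow_left e).mul_left ((S.commute_d 1 0).pow_left j)).mul_left
      ((S.commute_d 3 0).pow_left k)).mul_left ((S.commute_d 4 0).pow_left l)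
  exact LinearMap.congr_fun h.eq φ

lemma dpow_d_one (e j k l : ℕ) (φ : A) :
    S.dpow e j k l (S.d 1 φ) = S.dpow e (j + 1) k l φ := by
  have h1 : Commute ((S.d 3 : A →ₗ[ℂ] A) ^ k * (S.d 4 : A →ₗ[ℂ] A) ^ l) (S.d 1 : A →ₗ[ℂ] A) :=
    ((S.commute_d 3 1).pow_left k).mul_left ((S.commute_d 4 1).pow_left l)
  have h : S.dpow e j k l * (S.d 1 : A →ₗ[ℂ] A) = S.dpow e (j + 1) k l := by
    rw [dpow, dpow, pow_succ]
    simp only [mul_assoc] at h1 ⊢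
    rw [← h1.eq]
    simp only [mul_assoc]
  exact LinearMap.congr_fun h φ

lemma dpow_d_two (e j k l : ℕ) (φ : A) :
    S.dpow e j k l (S.d 2 φ) = S.dpow (e + 1) j k l φ := by
  have h1 : Commute ((S.d 1 : A →ₗ[ℂ] A) ^ j * (S.d 3 : A →ₗ[ℂ] A) ^ k
    * (S.d 4 : A →ₗ[ℂ] A) ^ l) (S.d 2 : A →ₗ[ℂ] A) :=
    (((S.commute_d 1 2).pow_left j).mul_left
      ((S.commute_d 3 2).pow_left k)).mul_left ((S.commute_d 4 2).pow_left l)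
  have h : S.dpow e j k l * (S.d 2 : A →ₗ[ℂ] A) = S.dpow (e + 1) j k l := by
    rw [dpow, dpow, pow_succ]
    simp only [mul_assoc] at h1 ⊢
    rw [← h1.eq]
    simp only [mul_assoc]
  exact LinearMap.congr_fun h φ

lemma dpow_d_three (e j k l : ℕ) (φ : A) :
    S.dpow e j k l (S.d 3 φ) = S.dpow e j (k + 1) l φ := by
  have h : S.dpow e j k l * (S.d 3 : A →ₗ[ℂ] A) = S.dpow e j (k + 1) l := by
    rw [dpow, dpow, pow_succ, mul_assoc, ((S.commute_d 4 3).pow_left l).eq]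
    simp only [mul_assoc]
  exact LinearMap.congr_fun h φ

lemma dpow_d_four (e j k l : ℕ) (φ : A) :
    S.dpow e j k l (S.d 4 φ) = S.dpow e j k (l + 1) φ := by
  have h : S.dpow e j k l * (S.d 4 : A →ₗ[ℂ] A) = S.dpow e j k (l + 1) := by
    rw [dpow, dpow, pow_succ]
    simp only [mul_assoc]
  exact LinearMap.congr_fun h φ

section rules

variable (e j k l : ℕ) (φ ψ : A) (c : ℂ) {t : ℝ}

lemma jet_add : S.jet e j k l (φ + ψ) t = S.jet e j k l φ t + S.jet e j k l ψ t := by simp [jet]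

lemma jet_sub : S.jet e j k l (φ - ψ) t = S.jet e j k l φ t - S.jet e j k l ψ t := by simp [jet]

lemma jet_smul : S.jet e j k l (c • φ) t = c * S.jet e j k l φ t := by simp [jet]

lemma jet_d_zero (ht : t ∈ Set.Ioo (0 : ℝ) 1) :
    S.jet e j k l (S.d 0 φ) t = deriv (S.jet e j k l φ) t := by
  rw [jet, dpow_d_zero]
  exact (S.hasDerivAt _ t ht).deriv.symm

lemma jet_d_one : S.jet e j k l (S.d 1 φ) t = S.jet e (j + 1) k l φ t := by
  rw [jet, dpow_d_one, jet]

lemma jet_d_two : S.jet e j k l (S.d 2 φ) t = S.jet (e + 1) j k l φ t := by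
  rw [jet, dpow_d_two, jet]

lemma jet_d_three : S.jet e j k l (S.d 3 φ) t = S.jet e j (k + 1) l φ t := by
  rw [jet, dpow_d_three, jet]

lemma jet_d_four : S.jet e j k l (S.d 4 φ) t = S.jet e j k (l + 1) φ t := by
  rw [jet, dpow_d_four, jet]

lemma jet_x_zero (ht : t ∈ Set.Ioo (0 : ℝ) 1) :
    S.jet e j k l (S.x 0 * φ) t = t * S.jet e j k l φ t := by
  simp only [jet, dpow, Module.End.mul_apply]
  rw [pow_mul_of_eq_zero (by simp [S.d_x]), pow_mul_of_eq_zero (by simp [S.d_x]),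
    pow_mul_of_eq_zero (by simp [S.d_x]), pow_mul_of_eq_zero (by simp [S.d_x]), map_mul,
    S.ev_zero t ht]

lemma jet_x_one (ht : t ∈ Set.Ioo (0 : ℝ) 1) :
    S.jet e j k l (S.x 1 * φ) t = j * S.jet e (j - 1) k l φ t := by
  simp only [jet, dpow, Module.End.mul_apply]
  rw [pow_mul_of_eq_zero (by simp [S.d_x]), pow_mul_of_eq_zero (by simp [S.d_x]),
    pow_mul_of_eq_one (by simp [S.d_x]), map_add, pow_mul_of_eq_zero (by simp [S.d_x]), map_add,
    map_mul, S.ev_ne_zero t ht 1 (by decide)]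
  simp

lemma jet_x_two (ht : t ∈ Set.Ioo (0 : ℝ) 1) :
    S.jet e j k l (S.x 2 * φ) t = e * S.jet (e - 1) j k l φ t := by
  simp only [jet, dpow, Module.End.mul_apply]
  rw [pow_mul_of_eq_zero (by simp [S.d_x]), pow_mul_of_eq_zero (by simp [S.d_x]),
    pow_mul_of_eq_zero (by simp [S.d_x]), pow_mul_of_eq_one (by simp [S.d_x]), map_add,
    map_mul, S.ev_ne_zero t ht 2 (by decide)]
  simp

lemma jet_x_three (ht : t ∈ Set.Ioo (0 : ℝ) 1) :
    S.jet e j k l (S.x 3 * φ) t = k * S.jet e j (k - 1) l φ t := by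
  simp only [jet, dpow, Module.End.mul_apply]
  rw [pow_mul_of_eq_zero (by simp [S.d_x]), pow_mul_of_eq_one (by simp [S.d_x]), map_add,
    map_add, pow_mul_of_eq_zero (by simp [S.d_x]), pow_mul_of_eq_zero (by simp [S.d_x]), map_add,
    map_mul, S.ev_ne_zero t ht 3 (by decide)]
  simp

lemma jet_x_four (ht : t ∈ Set.Ioo (0 : ℝ) 1) :
    S.jet e j k l (S.x 4 * φ) t = l * S.jet e j k (l - 1) φ t := by
  simp only [jet, dpow, Module.End.mul_apply]
  rw [pow_mul_of_eq_one (by simp [S.d_x]), map_add,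
    map_add, map_add, pow_mul_of_eq_zero (by simp [S.d_x]), pow_mul_of_eq_zero (by simp [S.d_x]),
    pow_mul_of_eq_zero (by simp [S.d_x]), map_add, map_mul, S.ev_ne_zero t ht 4 (by decide)]
  simp

end rules

lemma nat_mul_pred_succ (n : ℕ) (f : ℕ → ℂ) : (n : ℂ) * f (n - 1 + 1) = n * f n := by
  rcases n with _ | n <;> simp

end JetCurve

namespace JetCurve

variable {A : Type*} [CommRing A] [Algebra ℂ A] (S : JetCurve A)

/-- The Duffing field, up to a factor, in coordinates straightening the heteroclinic orbit. -/
def flow (ν : ℝ) (b δ : ℂ) (φ : A) : A :=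
  S.x 0 * S.d 0 φ - S.x 0 * (S.x 0 * S.d 0 φ) + S.x 1 * S.d 0 φ
    + ((2 : ℂ) • (S.x 0 * (S.x 1 * S.d 1 φ)) - S.x 1 * S.d 1 φ)
    + b • (S.x 3 * S.d 1 φ + S.x 4 * S.d 1 φ)
    - δ • (S.x 2 * (S.x 0 * S.d 1 φ - S.x 0 * (S.x 0 * S.d 1 φ) + S.x 1 * S.d 1 φ))
    + (ν * Complex.I) • (S.x 3 * S.d 3 φ - S.x 4 * S.d 4 φ)

lemma jet_flow (ν : ℝ) (b δ : ℂ) (e j k l : ℕ) (φ : A) {t : ℝ} (ht : t ∈ Set.Ioo (0 : ℝ) 1) :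
    S.jet e j k l (S.flow ν b δ φ) t
      = t * (1 - t) * deriv (S.jet e j k l φ) t + j * deriv (S.jet e (j - 1) k l φ) t
        + ((2 * t - 1) * j + (ν * (k - l) : ℝ) * Complex.I) * S.jet e j k l φ t
        + b * (k * S.jet e (j + 1) (k - 1) l φ t + l * S.jet e (j + 1) k (l - 1) φ t)
        - δ * e * ((t - t ^ 2) * S.jet (e - 1) (j + 1) k l φ t + j * S.jet (e - 1) j k l φ t) := by
  have h1 := nat_mul_pred_succ j fun i => S.jet e i k l φ t
  have h2 := nat_mul_pred_succ j fun i => S.jet (e - 1) i k l φ t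
  have h3 := nat_mul_pred_succ k fun i => S.jet e j i l φ t
  have h4 := nat_mul_pred_succ l fun i => S.jet e j k i φ t
  simp only [flow, jet_add, jet_sub, jet_smul, S.jet_x_zero _ _ _ _ _ ht,
    S.jet_x_one _ _ _ _ _ ht, S.jet_x_two _ _ _ _ _ ht, S.jet_x_three _ _ _ _ _ ht,
    S.jet_x_four _ _ _ _ _ ht, S.jet_d_zero _ _ _ _ _ ht, jet_d_one, jet_d_three, jet_d_four,
    h1, h2, h3, h4]
  push_cast
  ring

lemma deriv_eq_zero_of_forall_Ioo {h : ℝ → ℂ} (hh : ∀ t ∈ Set.Ioo (0 : ℝ) 1, h t = 0) {t : ℝ}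
    (ht : t ∈ Set.Ioo (0 : ℝ) 1) : deriv h t = 0 := by
  have : h =ᶠ[𝓝 t] fun _ => 0 := by
    filter_upwards [isOpen_Ioo.mem_nhds ht] with s hs using hh s hs
  rw [this.deriv_eq, deriv_const]

lemma jet_analytic (e j k l : ℕ) (φ : A) :
    AnalyticOnNhd ℝ (S.jet e j k l φ) (Set.Icc 0 1) := S.analytic _

lemma natCast_mul_eq_zero {n : ℕ} {z : ℂ} (h : 1 ≤ n → z = 0) : (n : ℂ) * z = 0 := by
  rcases Nat.eq_zero_or_pos n with rfl | hn
  · simp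
  · rw [h hn, mul_zero]

/-- Solutions of the variational equation have vanishing jets along the heteroclinic orbit. -/
theorem jet_eq_zero_of_flow {ν : ℝ} {b δ lam₁ lam₂ lam₃ lam₄ : ℂ} (hν : ν ≠ 0) (hb : b ≠ 0)
    {a c : A}
    (hfa : S.flow ν b δ a
      = c + (a - (2 : ℂ) • (S.x 0 * a)) + lam₁ • (S.x 2 * a))
    (hfc : S.flow ν b δ c
      = (2 : ℂ) • (S.x 1 * a) + ((2 : ℂ) • (S.x 0 * c) - c)
        + S.x 2 * (lam₂ • c + lam₃ • a + lam₄ • (S.x 0 * a))) :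
    (∀ e j k l, ∀ t ∈ Set.Ioo (0 : ℝ) 1, S.jet e j k l a t = 0) ∧
      ∀ e j k l, ∀ t ∈ Set.Ioo (0 : ℝ) 1, S.jet e j k l c t = 0 := by
  suffices H : ∀ N : ℕ,
      (∀ e j k l, 2 * e + j + k + l + 1 < N → ∀ t ∈ Set.Ioo (0 : ℝ) 1, S.jet e j k l a t = 0) ∧
      (∀ e j k l, 2 * e + j + k + l < N → ∀ t ∈ Set.Ioo (0 : ℝ) 1, S.jet e j k l c t = 0) from
    ⟨fun e j k l => (H _).1 e j k l (Nat.lt_succ_self _),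
      fun e j k l => (H _).2 e j k l (Nat.lt_succ_self _)⟩
  intro N
  induction N with
  | zero => exact ⟨fun e j k l h => absurd h (by omega), fun e j k l h => absurd h (by omega)⟩
  | succ N ih =>
  obtain ⟨ihA, ihC⟩ := ih
  have eqA : ∀ e j k l, 2 * e + j + k + l + 1 = N → ∀ t ∈ Set.Ioo (0 : ℝ) 1,
      (t : ℂ) * (1 - t) * deriv (S.jet e j k l a) t
        + ((2 * t - 1) * (j + 1 : ℕ) + (ν * (k - l) : ℝ) * Complex.I) * S.jet e j k l a t
        + b * (k * S.jet e (j + 1) (k - 1) l a t + l * S.jet e (j + 1) k (l - 1) a t) = 0 := by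
    intro e j k l hN t ht
    have h := congrArg (fun φ => S.jet e j k l φ t) hfa
    simp only [S.jet_flow _ _ _ _ _ _ _ _ ht, jet_add, jet_sub, jet_smul,
      S.jet_x_zero _ _ _ _ _ ht, S.jet_x_two _ _ _ _ _ ht] at h
    have h1 : (j : ℂ) * deriv (S.jet e (j - 1) k l a) t = 0 := natCast_mul_eq_zero fun hj =>
      deriv_eq_zero_of_forall_Ioo (fun s hs => ihA _ _ _ _ (by omega) s hs) ht
    have h2 : (e : ℂ) * S.jet (e - 1) (j + 1) k l a t = 0 :=
      natCast_mul_eq_zero fun _ => ihA _ _ _ _ (by omega) t ht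
    have h3 : (e : ℂ) * S.jet (e - 1) j k l a t = 0 :=
      natCast_mul_eq_zero fun _ => ihA _ _ _ _ (by omega) t ht
    have h4 : S.jet e j k l c t = 0 := ihC _ _ _ _ (by omega) t ht
    push_cast at h ⊢
    linear_combination h - h1 + δ * (t - t ^ 2) * h2 + (δ * j + lam₁) * h3 + h4
  have eqC : ∀ e j k l, 2 * e + j + k + l = N → ∀ t ∈ Set.Ioo (0 : ℝ) 1,
      (t : ℂ) * (1 - t) * deriv (S.jet e j k l c) t
        + ((2 * t - 1) * (j - 1) + (ν * (k - l) : ℝ) * Complex.I) * S.jet e j k l c t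
        + b * (k * S.jet e (j + 1) (k - 1) l c t + l * S.jet e (j + 1) k (l - 1) c t)
        = 2 * (j * S.jet e (j - 1) k l a t) := by
    intro e j k l hN t ht
    have h := congrArg (fun φ => S.jet e j k l φ t) hfc
    simp only [S.jet_flow _ _ _ _ _ _ _ _ ht, jet_add, jet_sub, jet_smul,
      S.jet_x_zero _ _ _ _ _ ht, S.jet_x_one _ _ _ _ _ ht, S.jet_x_two _ _ _ _ _ ht] at h
    have h1 : (j : ℂ) * deriv (S.jet e (j - 1) k l c) t = 0 := natCast_mul_eq_zero fun hj =>
      deriv_eq_zero_of_forall_Ioo (fun s hs => ihC _ _ _ _ (by omega) s hs) ht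
    have h2 : (e : ℂ) * S.jet (e - 1) (j + 1) k l c t = 0 :=
      natCast_mul_eq_zero fun _ => ihC _ _ _ _ (by omega) t ht
    have h3 : (e : ℂ) * S.jet (e - 1) j k l c t = 0 :=
      natCast_mul_eq_zero fun _ => ihC _ _ _ _ (by omega) t ht
    have h4 : (e : ℂ) * S.jet (e - 1) j k l a t = 0 :=
      natCast_mul_eq_zero fun _ => ihA _ _ _ _ (by omega) t ht
    push_cast at h ⊢
    linear_combination h - h1 + δ * (t - t ^ 2) * h2 + (δ * j + lam₂) * h3
      + (lam₃ + lam₄ * t) * h4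
  have offA : ∀ e j k l, 2 * e + j + k + l + 1 = N → (1 ≤ j ∨ k ≠ l) →
      ∀ t ∈ Set.Ioo (0 : ℝ) 1, S.jet e j k l a t = 0 := by
    intro e j k l hN hjkl
    exact family_eq_zero (B := fun j k l => S.jet e j k l a) (M := j + k + l) (o := 1) hν hb
      (fun _ _ _ => S.jet_analytic _ _ _ _ _)
      (fun j' k' l' h' _ => eqA e j' k' l' (by omega)) j k l rfl hjkl
  have offC : ∀ e j k l, 2 * e + (j + 1) + k + l = N → (1 ≤ j ∨ k ≠ l) →
      ∀ t ∈ Set.Ioo (0 : ℝ) 1, S.jet e (j + 1) k l c t = 0 := by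
    intro e j k l hN hjkl
    refine family_eq_zero (B := fun j k l => S.jet e (j + 1) k l c) (M := j + k + l) (o := 0) hν hb
      (fun _ _ _ => S.jet_analytic _ _ _ _ _)
      (fun j' k' l' h' hjkl' t ht => ?_) j k l rfl hjkl
    have h := eqC e (j' + 1) k' l' (by omega) t ht
    rw [Nat.add_sub_cancel, offA e j' k' l' (by omega) hjkl' t ht] at h
    push_cast at h ⊢
    linear_combination h
  have diag : ∀ e k, 2 * e + 1 + k + k = N → ∀ t ∈ Set.Ioo (0 : ℝ) 1,
      S.jet e 0 k k a t = 0 ∧ S.jet e 1 k k c t = 0 := by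
    intro e k hN
    obtain ⟨κ, hκ⟩ := solution_eq_const_mul (n := 1) (S.jet_analytic e 0 k k a) fun t ht => by
      have h := eqA e 0 k k (by omega) t ht
      have h1 : (k : ℂ) * S.jet e (0 + 1) (k - 1) k a t = 0 :=
        natCast_mul_eq_zero fun _ => offA _ _ _ _ (by omega) (Or.inl le_rfl) t ht
      have h2 : (k : ℂ) * S.jet e (0 + 1) k (k - 1) a t = 0 :=
        natCast_mul_eq_zero fun _ => offA _ _ _ _ (by omega) (Or.inl le_rfl) t ht
      push_cast at h ⊢
      linear_combination h - b * h1 - b * h2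
    obtain ⟨κ₀, hκ₀⟩ := solution_eq_affine (κ := κ) (S.jet_analytic e 1 k k c) fun t ht => by
      have h := eqC e 1 k k (by omega) t ht
      have h1 : (k : ℂ) * S.jet e (1 + 1) (k - 1) k c t = 0 :=
        natCast_mul_eq_zero fun _ => offC _ _ _ _ (by omega) (Or.inl le_rfl) t ht
      have h2 : (k : ℂ) * S.jet e (1 + 1) k (k - 1) c t = 0 :=
        natCast_mul_eq_zero fun _ => offC _ _ _ _ (by omega) (Or.inl le_rfl) t ht
      rw [Nat.sub_self, hκ t ht] at h
      push_cast at h ⊢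
      linear_combination h - b * h1 - b * h2
    have hk : (k : ℂ) + 1 ≠ 0 := by exact_mod_cast k.succ_ne_zero
    have r1 := forcing_relation_of_pole (μ := ν) (κ₀ := -b * (k + 1) * κ₀)
      (κ₁ := -b * (k + 1) * κ) (S.jet_analytic e 0 (k + 1) k c) fun t ht => by
      have h := eqC e 0 (k + 1) k (by omega) t ht
      have h1 : (k : ℂ) * S.jet e (0 + 1) (k + 1) (k - 1) c t = 0 :=
        natCast_mul_eq_zero fun _ => offC _ _ _ _ (by omega) (Or.inr (by omega)) t ht
      rw [Nat.add_sub_cancel, zero_add, hκ₀ t ht] at h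
      push_cast at h ⊢
      linear_combination h - b * h1
    have r2 := forcing_relation_of_pole (μ := -ν) (κ₀ := -b * (k + 1) * κ₀)
      (κ₁ := -b * (k + 1) * κ) (S.jet_analytic e 0 k (k + 1) c) fun t ht => by
      have h := eqC e 0 k (k + 1) (by omega) t ht
      have h1 : (k : ℂ) * S.jet e (0 + 1) (k - 1) (k + 1) c t = 0 :=
        natCast_mul_eq_zero fun _ => offC _ _ _ _ (by omega) (Or.inr (by omega)) t ht
      rw [Nat.add_sub_cancel, zero_add, hκ₀ t ht] at h
      push_cast at h ⊢
      linear_combination h - b * h1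
    have z0 : (b * (k + 1)) * κ₀ = 0 := by
      push_cast at r1 r2
      linear_combination -(1 / 2) * r1 - (1 / 2) * r2
    have z1 : (b * (k + 1) * (ν * Complex.I)) * κ = 0 := by
      push_cast at r1 r2
      linear_combination -(1 / 2) * r1 + (1 / 2) * r2
    have hκ₀0 : κ₀ = 0 := by simpa [hb, hk] using z0
    have hκ0 : κ = 0 := by simpa [hb, hk, hν, Complex.I_ne_zero] using z1
    intro t ht
    rw [hκ t ht, hκ₀ t ht, hκ0, hκ₀0]
    simp
  have allA : ∀ e j k l, 2 * e + j + k + l + 1 = N → ∀ t ∈ Set.Ioo (0 : ℝ) 1,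
      S.jet e j k l a t = 0 := by
    intro e j k l hN t ht
    by_cases h : 1 ≤ j ∨ k ≠ l
    · exact offA e j k l hN h t ht
    · obtain ⟨rfl, rfl⟩ : j = 0 ∧ k = l := by omega
      exact (diag e k (by omega) t ht).1
  have allC' : ∀ e j k l, 2 * e + (j + 1) + k + l = N → ∀ t ∈ Set.Ioo (0 : ℝ) 1,
      S.jet e (j + 1) k l c t = 0 := by
    intro e j k l hN t ht
    by_cases h : 1 ≤ j ∨ k ≠ l
    · exact offC e j k l hN h t ht
    · obtain ⟨rfl, rfl⟩ : j = 0 ∧ k = l := by omega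
      exact (diag e k (by omega) t ht).2
  have allC : ∀ e j k l, 2 * e + j + k + l = N → ∀ t ∈ Set.Ioo (0 : ℝ) 1,
      S.jet e j k l c t = 0 := by
    intro e j k l hN
    rcases j with _ | j
    · refine solution_eq_zero_of_pole (μ := ν * (k - l)) (S.jet_analytic _ _ _ _ _) fun t ht => ?_
      have h := eqC e 0 k l hN t ht
      have h1 : (k : ℂ) * S.jet e (0 + 1) (k - 1) l c t = 0 :=
        natCast_mul_eq_zero fun _ => allC' _ _ _ _ (by omega) t ht
      have h2 : (l : ℂ) * S.jet e (0 + 1) k (l - 1) c t = 0 :=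
        natCast_mul_eq_zero fun _ => allC' _ _ _ _ (by omega) t ht
      push_cast at h ⊢
      linear_combination h - b * h1 - b * h2
    · exact allC' e j k l hN
  constructor
  · intro e j k l h
    rcases (Nat.lt_succ_iff_lt_or_eq.1 h) with h | h
    · exact ihA e j k l h
    · exact allA e j k l h
  · intro e j k l h
    rcases (Nat.lt_succ_iff_lt_or_eq.1 h) with h | h
    · exact ihC e j k l h
    · exact allC e j k l h

end JetCurve

open TopologicalSpace (Opens)

/-- A function whose Taylor coefficients at a point all vanish and that is analytic there vanishes
near the point. -/
lemma AnalyticAt.eventually_eq_zero_of_iteratedFDeriv {E F : Type*} [NormedAddCommGroup E]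
    [NormedSpace ℝ E] [NormedAddCommGroup F] [NormedSpace ℝ F] [CompleteSpace F] {f : E → F}
    {x : E} (hf : AnalyticAt ℝ f x) (h : ∀ n v, iteratedFDeriv ℝ n f x (fun _ => v) = 0) :
    f =ᶠ[𝓝 x] 0 := by
  obtain ⟨q, r, hq⟩ := hf
  have hz : ∀ n v, q n (fun _ => v) = 0 := fun n v => by
    have := hq.factorial_smul v n
    rw [h n v, ← Nat.cast_smul_eq_nsmul ℝ] at this
    exact (smul_eq_zero.1 this).resolve_left (Nat.cast_ne_zero.2 n.factorial_ne_zero)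
  have h0 := hq.eventually_hasSum_sub
  filter_upwards [h0] with y hy
  simp only [hz] at hy
  exact hy.unique hasSum_zero

section AnalyticAlgebra

variable {E : Type*} [NormedAddCommGroup E] [NormedSpace ℝ E]

/-- The algebra of complex-valued real-analytic functions on an open set. -/
def AnalyticAlgebra (U : Opens E) : Subalgebra ℂ (U → ℂ) where
  carrier := {φ | ∃ Φ : E → ℂ, AnalyticOnNhd ℝ Φ U ∧ ∀ x : U, φ x = Φ x}
  mul_mem' := by
    rintro φ ψ ⟨Φ, hΦ, h1⟩ ⟨Ψ, hΨ, h2⟩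
    exact ⟨fun x => Φ x * Ψ x, hΦ.mul hΨ, fun x => by simp [h1, h2]⟩
  add_mem' := by
    rintro φ ψ ⟨Φ, hΦ, h1⟩ ⟨Ψ, hΨ, h2⟩
    exact ⟨fun x => Φ x + Ψ x, hΦ.add hΨ, fun x => by simp [h1, h2]⟩
  algebraMap_mem' c := ⟨fun _ => c, analyticOnNhd_const, fun _ => rfl⟩

namespace AnalyticAlgebra

variable {U : Opens E}

/-- The restriction to `U` of a function analytic there. -/
def mk (Φ : E → ℂ) (h : AnalyticOnNhd ℝ Φ U) : AnalyticAlgebra U :=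
  ⟨fun x => Φ x, Φ, h, fun _ => rfl⟩

/-- Extension by zero. -/
noncomputable def ext (φ : AnalyticAlgebra U) : E → ℂ := Function.extend Subtype.val φ.1 0

lemma ext_apply (φ : AnalyticAlgebra U) (x : U) : ext φ x = φ.1 x :=
  Subtype.val_injective.extend_apply _ _ _

@[simp] lemma mk_apply (Φ : E → ℂ) (h : AnalyticOnNhd ℝ Φ U) (x : U) : (mk Φ h).1 x = Φ x := rfl

lemma ext_eq_iff {φ ψ : AnalyticAlgebra U} : φ = ψ ↔ ∀ x : U, φ.1 x = ψ.1 x :=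
  ⟨fun h => by simp [h], fun h => Subtype.ext (funext h)⟩

lemma eventuallyEq_of_forall {E : Type*} [TopologicalSpace E] {U : Opens E} {Φ Ψ : E → ℂ} (h : ∀ x : U, Φ x = Ψ x) (x : U) :
    Φ =ᶠ[𝓝 (x : E)] Ψ := by
  filter_upwards [U.2.mem_nhds x.2] with y hy using h ⟨y, hy⟩

lemma analyticOnNhd_ext (φ : AnalyticAlgebra U) : AnalyticOnNhd ℝ (ext φ) U := by
  obtain ⟨Φ, hΦ, h⟩ := φ.2
  exact fun x hx => (hΦ x hx).congr
    (eventuallyEq_of_forall (fun y => ((ext_apply φ y).trans (h y)).symm) ⟨x, hx⟩)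

lemma differentiableAt_ext (φ : AnalyticAlgebra U) (x : U) : DifferentiableAt ℝ (ext φ) x :=
  (analyticOnNhd_ext φ x x.2).differentiableAt

lemma ext_add (φ ψ : AnalyticAlgebra U) (x : U) : ext (φ + ψ) =ᶠ[𝓝 (x : E)] ext φ + ext ψ :=
  eventuallyEq_of_forall (fun y => by rw [Pi.add_apply, ext_apply, ext_apply, ext_apply]; rfl) x

lemma ext_mul (φ ψ : AnalyticAlgebra U) (x : U) : ext (φ * ψ) =ᶠ[𝓝 (x : E)] ext φ * ext ψ :=
  eventuallyEq_of_forall (fun y => by rw [Pi.mul_apply, ext_apply, ext_apply, ext_apply]; rfl) x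

lemma ext_smul (c : ℂ) (φ : AnalyticAlgebra U) (x : U) : ext (c • φ) =ᶠ[𝓝 (x : E)] c • ext φ :=
  eventuallyEq_of_forall (fun y => by rw [Pi.smul_apply, ext_apply, ext_apply]; rfl) x

lemma ext_mk (Φ : E → ℂ) (h : AnalyticOnNhd ℝ Φ U) (x : U) : ext (mk Φ h) =ᶠ[𝓝 (x : E)] Φ :=
  eventuallyEq_of_forall (fun y => by rw [ext_apply, mk_apply]) x

/-- Differentiation in the direction `v`. -/
noncomputable def dir (v : E) : Derivation ℂ (AnalyticAlgebra U) (AnalyticAlgebra U) :=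
  Derivation.mk'
    { toFun := fun φ => mk (fun x => fderiv ℝ (ext φ) x v) fun x hx =>
        ((ContinuousLinearMap.apply ℝ ℂ v).analyticAt _).comp ((analyticOnNhd_ext φ).fderiv x hx)
      map_add' := fun φ ψ => ext_eq_iff.2 fun x => by
        change fderiv ℝ (ext (φ + ψ)) x v = fderiv ℝ (ext φ) x v + fderiv ℝ (ext ψ) x v
        rw [(ext_add φ ψ x).fderiv_eq,
          fderiv_add (differentiableAt_ext φ x) (differentiableAt_ext ψ x)]
        rfl
      map_smul' := fun c φ => ext_eq_iff.2 fun x => by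
        change fderiv ℝ (ext (c • φ)) x v = c * fderiv ℝ (ext φ) x v
        rw [(ext_smul c φ x).fderiv_eq, fderiv_const_smul (differentiableAt_ext φ x)]
        rfl }
    fun φ ψ => ext_eq_iff.2 fun x => by
      change fderiv ℝ (ext (φ * ψ)) x v
        = φ.1 x * fderiv ℝ (ext ψ) x v + ψ.1 x * fderiv ℝ (ext φ) x v
      rw [(ext_mul φ ψ x).fderiv_eq,
        fderiv_mul (differentiableAt_ext φ x) (differentiableAt_ext ψ x), ext_apply, ext_apply]
      rfl

lemma dir_apply (v : E) (φ : AnalyticAlgebra U) (x : U) :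
    (dir v φ).1 x = fderiv ℝ (ext φ) x v := rfl

lemma ext_dir (v : E) (φ : AnalyticAlgebra U) (x : U) :
    ext (dir v φ) =ᶠ[𝓝 (x : E)] fun y => fderiv ℝ (ext φ) y v :=
  eventuallyEq_of_forall (fun y => by rw [ext_apply, dir_apply]) x

lemma dir_mk (Φ : E → ℂ) (h : AnalyticOnNhd ℝ Φ U) (v : E) (x : U) :
    (dir v (mk Φ h)).1 x = fderiv ℝ Φ x v := by
  rw [dir_apply, (ext_mk Φ h x).fderiv_eq]

lemma dir_dir_apply (v w : E) (φ : AnalyticAlgebra U) (x : U) :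
    (dir v (dir w φ)).1 x = fderiv ℝ (fderiv ℝ (ext φ)) x v w := by
  rw [dir_apply, (ext_dir w φ x).fderiv_eq,
    fderiv_clm_apply ((analyticOnNhd_ext φ).fderiv x x.2).differentiableAt
      (differentiableAt_const w)]
  simp

lemma dir_comm (v w : E) (φ : AnalyticAlgebra U) : dir v (dir w φ) = dir w (dir v φ) := by
  refine ext_eq_iff.2 fun x => ?_
  rw [dir_dir_apply, dir_dir_apply]
  exact ((analyticOnNhd_ext φ x x.2).contDiffAt (n := 2)).isSymmSndFDerivAt (by simp) v w

lemma eq_zero_of_eventuallyEq (hU : IsPreconnected (U : Set E)) (φ : AnalyticAlgebra U) (x : U)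
    (h : ext φ =ᶠ[𝓝 (x : E)] 0) : φ = 0 := by
  refine ext_eq_iff.2 fun y => ?_
  rw [← ext_apply,
    (analyticOnNhd_ext φ).eqOn_zero_of_preconnected_of_eventuallyEq_zero hU x.2 h y.2]
  rfl

lemma eq_zero_or_eq_zero (hU : IsPreconnected (U : Set E)) {φ ψ : AnalyticAlgebra U}
    (h : φ * ψ = 0) : φ = 0 ∨ ψ = 0 := by
  by_cases hφ : φ = 0
  · exact Or.inl hφ
  obtain ⟨x, hx⟩ : ∃ x : U, φ.1 x ≠ 0 := by
    by_contra! hcon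
    exact hφ (ext_eq_iff.2 hcon)
  right
  refine eq_zero_of_eventuallyEq hU ψ x ?_
  have hc : ∀ᶠ y in 𝓝 (x : E), ext φ y ≠ 0 :=
    (differentiableAt_ext φ x).continuousAt.eventually_ne (by rwa [ext_apply])
  filter_upwards [hc, U.2.mem_nhds x.2] with y hy hyU
  have h0 : φ.1 ⟨y, hyU⟩ * ψ.1 ⟨y, hyU⟩ = 0 := ext_eq_iff.1 h ⟨y, hyU⟩
  rw [← ext_apply, ← ext_apply] at h0
  exact (mul_eq_zero.1 h0).resolve_left hy

lemma iteratedFDeriv_eq_zero {P : AnalyticAlgebra U → Prop} {x : U}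
    (hdir : ∀ v φ, P φ → P (dir v φ)) (hx : ∀ φ, P φ → φ.1 x = 0) (n : ℕ) :
    ∀ φ, P φ → ∀ m, iteratedFDeriv ℝ n (ext φ) x m = 0 := by
  induction n with
  | zero => intro φ hφ m; rw [iteratedFDeriv_zero_apply, ext_apply, hx φ hφ]
  | succ n ih =>
    intro φ hφ m
    have hf := (analyticOnNhd_ext φ).fderiv x x.2
    have e := ContinuousLinearMap.iteratedFDeriv_comp_left (i := n)
      (ContinuousLinearMap.apply ℝ ℂ (m (Fin.last n))) (hf.contDiffAt (n := n)) le_rfl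
    have e1 := (ext_dir (m (Fin.last n)) φ x).iteratedFDeriv (𝕜 := ℝ) n
    have e2 := ih _ (hdir (m (Fin.last n)) φ hφ) (Fin.init m)
    rw [e1.eq_of_nhds] at e2
    rw [iteratedFDeriv_succ_apply_right, ← e2]
    exact (congrArg (fun M => M (Fin.init m)) e).symm

/-- An element of a class of functions that is stable under differentiation and consists of
functions vanishing at a point is zero. -/
lemma eq_zero_of_stable (hU : IsPreconnected (U : Set E)) {P : AnalyticAlgebra U → Prop} {x : U}
    (hdir : ∀ v φ, P φ → P (dir v φ)) (hx : ∀ φ, P φ → φ.1 x = 0) {φ : AnalyticAlgebra U}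
    (hφ : P φ) : φ = 0 :=
  eq_zero_of_eventuallyEq hU φ x <|
    (analyticOnNhd_ext φ x x.2).eventually_eq_zero_of_iteratedFDeriv fun n v =>
      iteratedFDeriv_eq_zero hdir hx n φ hφ fun _ => v

end AnalyticAlgebra

end AnalyticAlgebra

/-- Commuting derivations with dual coordinates, labelled `(x₁, x₂, ε, u₁, u₂)`. -/
structure Chart (A : Type*) [CommRing A] [Algebra ℂ A] where
  D : Fin 5 → Derivation ℂ A A
  X : Fin 5 → A
  comm : ∀ i j φ, D i (D j φ) = D j (D i φ)
  D_X : ∀ i j, D i (X j) = if i = j then 1 else 0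

/-- The constant `√2`. -/
noncomputable def rt : ℂ := (√2 : ℝ)

lemma rt_mul_rt : rt * rt = 2 := by
  rw [rt, ← Complex.ofReal_mul, Real.mul_self_sqrt (by norm_num)]
  norm_num

lemma rt_ne_zero : rt ≠ 0 := fun h => by
  have := rt_mul_rt
  rw [h] at this
  norm_num at this

namespace Chart

variable {A : Type*} [CommRing A] [Algebra ℂ A] (T : Chart A)

/-- Partial derivatives in the straightening coordinates. -/
noncomputable def straightD : Fin 5 → Derivation ℂ A A :=
  ![(2 : ℂ) • (T.D 0 - rt • T.X 0 • T.D 1), (2 * rt) • T.D 1, T.D 2,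
    (1 / 2 : ℂ) • (T.D 3 - Complex.I • T.D 4), (1 / 2 : ℂ) • (T.D 3 + Complex.I • T.D 4)]

/-- The straightening coordinates. -/
noncomputable def straightX : Fin 5 → A :=
  ![(1 / 2 : ℂ) • (T.X 0 + 1), (rt / 4) • T.X 1 - (1 / 4 : ℂ) • (1 - T.X 0 * T.X 0), T.X 2,
    T.X 3 + Complex.I • T.X 4, T.X 3 - Complex.I • T.X 4]

lemma straightD_comm (i j : Fin 5) (φ : A) :
    T.straightD i (T.straightD j φ) = T.straightD j (T.straightD i φ) := by
  have c (i j : Fin 5) := T.comm i j φ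
  fin_cases i <;> fin_cases j <;>
  simp [straightD, T.D_X, c 1 0, c 2 0, c 3 0, c 4 0, c 2 1, c 3 1, c 4 1, c 3 2, c 4 2, c 4 3,
    mul_add, mul_sub] <;>
  module

lemma straightD_straightX (i j : Fin 5) :
    T.straightD i (T.straightX j) = if i = j then 1 else 0 := by
  have h : (2 : ℂ) * rt * (rt / 4) = 1 := by linear_combination (1 / 2) * rt_mul_rt
  fin_cases i <;> fin_cases j <;>
  simp [straightD, straightX, T.D_X, smul_smul, h]
  · rw [← add_smul, ← sub_smul, show (4⁻¹ + 4⁻¹ - rt * (rt / 4) : ℂ) = 0 by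
      linear_combination -(1 / 4) * rt_mul_rt, zero_smul]
  · module
  · rw [← add_smul, mul_assoc, Complex.I_mul_I, show (2⁻¹ + 2⁻¹ * -1 : ℂ) = 0 by norm_num, zero_smul]
  · rw [← sub_eq_add_neg, ← sub_smul, mul_assoc, Complex.I_mul_I,
      show (2⁻¹ - 2⁻¹ * -1 : ℂ) = 1 by norm_num, one_smul]

/-- The Duffing field as a derivation. -/
noncomputable def duffing (β δ ω : ℂ) : Derivation ℂ A A :=
  T.X 1 • T.D 0 + (-T.X 0 + T.X 0 ^ 3 - δ • (T.X 2 * T.X 1) + β • T.X 3) • T.D 1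
    - (ω • T.X 4) • T.D 3 + (ω • T.X 3) • T.D 4

end Chart

section Constants

variable (A : Type*) [CommRing A] [Algebra ℂ A]

lemma eight_mul_algebraMap_rt_sq :
    8 * algebraMap ℂ A (rt / 4) * algebraMap ℂ A (rt / 4) = 1 := by
  rw [mul_assoc, ← map_mul, ← map_ofNat (algebraMap ℂ A) 8, ← map_mul, ← map_one (algebraMap ℂ A)]
  congr 1
  linear_combination (1 / 2) * rt_mul_rt

lemma algebraMap_rt : algebraMap ℂ A rt = 4 * algebraMap ℂ A (rt / 4) := by
  rw [← map_ofNat (algebraMap ℂ A) 4, ← map_mul]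
  congr 1
  ring

lemma algebraMap_one_half :
    algebraMap ℂ A (1 / 2) = 4 * algebraMap ℂ A (rt / 4) * algebraMap ℂ A (rt / 4) := by
  rw [← map_ofNat (algebraMap ℂ A) 4, ← map_mul, ← map_mul]
  congr 1
  linear_combination -(1 / 4) * rt_mul_rt

lemma algebraMap_one_quarter :
    algebraMap ℂ A (1 / 4) = 2 * algebraMap ℂ A (rt / 4) * algebraMap ℂ A (rt / 4) := by
  rw [← map_ofNat (algebraMap ℂ A) 2, ← map_mul, ← map_mul]
  congr 1
  linear_combination -(1 / 8) * rt_mul_rt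

end Constants

/-- A chart whose straightening coordinates carry a jet structure determining the functions. -/
structure DuffingChart (A : Type*) [CommRing A] [Algebra ℂ A] extends Chart A where
  S : JetCurve A
  S_d : S.d = toChart.straightD
  S_x : S.x = toChart.straightX
  eq_zero_of_stable : ∀ N : Submodule ℂ A, (∀ i, ∀ φ ∈ N, D i φ ∈ N) →
    (∀ φ ∈ N, S.ev (1 / 2) φ = 0) → ∀ φ ∈ N, φ = 0

namespace DuffingChart

variable {A : Type*} [CommRing A] [Algebra ℂ A] (T : DuffingChart A)

/-- Functions with vanishing jets along the curve. -/
def flat : Submodule ℂ A where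
  carrier := {φ | ∀ e j k l, ∀ t ∈ Set.Ioo (0 : ℝ) 1, T.S.jet e j k l φ t = 0}
  add_mem' := by
    intro φ ψ hφ hψ e j k l t ht
    rw [JetCurve.jet_add, hφ e j k l t ht, hψ e j k l t ht, add_zero]
  zero_mem' := by intro e j k l t _; simp [JetCurve.jet]
  smul_mem' := by
    intro c φ hφ e j k l t ht
    rw [JetCurve.jet_smul, hφ e j k l t ht, mul_zero]

lemma d_mem_flat (i : Fin 5) {φ : A} (hφ : φ ∈ T.flat) : T.S.d i φ ∈ T.flat := by
  intro e j k l t ht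
  fin_cases i
  · change T.S.jet e j k l (T.S.d 0 φ) t = 0
    rw [T.S.jet_d_zero _ _ _ _ _ ht]
    exact JetCurve.deriv_eq_zero_of_forall_Ioo (fun s hs => hφ e j k l s hs) ht
  · exact (T.S.jet_d_one e j k l φ).trans (hφ _ _ _ _ t ht)
  · exact (T.S.jet_d_two e j k l φ).trans (hφ _ _ _ _ t ht)
  · exact (T.S.jet_d_three e j k l φ).trans (hφ _ _ _ _ t ht)
  · exact (T.S.jet_d_four e j k l φ).trans (hφ _ _ _ _ t ht)

lemma x_zero_mul_mem_flat {φ : A} (hφ : φ ∈ T.flat) : T.S.x 0 * φ ∈ T.flat := by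
  intro e j k l t ht
  rw [T.S.jet_x_zero _ _ _ _ _ ht, hφ e j k l t ht, mul_zero]

lemma D_mem_flat (i : Fin 5) {φ : A} (hφ : φ ∈ T.flat) : T.D i φ ∈ T.flat := by
  have h (i) := T.d_mem_flat i hφ
  have h0 := h 0
  have h1 := h 1
  have h2 := h 2
  have h3 := h 3
  have h4 := h 4
  have hx {ψ : A} (hψ : ψ ∈ T.flat) := T.x_zero_mul_mem_flat hψ
  simp only [T.S_d, T.S_x, Chart.straightD, Chart.straightX, Matrix.cons_val] at h0 h1 h2 h3 h4 hx
  have m1 : T.D 1 φ ∈ T.flat := by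
    have := T.flat.smul_mem (2 * rt)⁻¹ h1
    rwa [Derivation.smul_apply, smul_smul,
      inv_mul_cancel₀ (mul_ne_zero two_ne_zero rt_ne_zero), one_smul] at this
  fin_cases i
  · have m2 : T.X 0 * T.D 1 φ ∈ T.flat := by
      have := T.flat.sub_mem (T.flat.smul_mem 2 (hx m1)) m1
      convert this using 1
      rw [smul_mul_assoc, smul_smul]
      norm_num [add_mul]
    have := T.flat.add_mem (T.flat.smul_mem (1 / 2) h0) (T.flat.smul_mem rt m2)
    convert this using 1
    simp [smul_smul]
  · exact m1
  · exact h2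
  · change T.D 3 φ ∈ T.flat
    convert T.flat.add_mem h3 h4 using 1
    simp only [Derivation.smul_apply, Derivation.add_apply, Derivation.sub_apply]
    module
  · change T.D 4 φ ∈ T.flat
    convert T.flat.smul_mem Complex.I (T.flat.sub_mem h3 h4) using 1
    simp only [Derivation.smul_apply, Derivation.add_apply, Derivation.sub_apply]
    have := Complex.I_mul_I
    match_scalars
    · linear_combination this
    · ring

lemma eq_zero_of_mem_flat {φ : A} (hφ : φ ∈ T.flat) : φ = 0 :=
  T.eq_zero_of_stable T.flat (fun i _ h => T.D_mem_flat i h)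
    (fun φ h => by simpa [JetCurve.jet, JetCurve.dpow] using h 0 0 0 0 (1 / 2) (by norm_num)) φ hφ

lemma smul_flow (β δ : ℂ) (ω : ℝ) (φ : A) :
    rt • T.S.flow (ω / √2) (β / 8) (δ / rt) φ = T.duffing β δ ω φ := by
  obtain ⟨q, hq⟩ : ∃ q : A, q = algebraMap ℂ A (rt / 4) := ⟨_, rfl⟩
  obtain ⟨J, hJ⟩ : ∃ J : A, J = algebraMap ℂ A Complex.I := ⟨_, rfl⟩
  have h8 : 8 * q * q = 1 := hq ▸ eight_mul_algebraMap_rt_sq A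
  have hJ2 : J * J = -1 := by
    rw [hJ, ← map_mul, Complex.I_mul_I, map_neg, map_one]
  have a1 : algebraMap ℂ A rt = 4 * q := hq ▸ algebraMap_rt A
  have a2 : algebraMap ℂ A (1 / 2) = 4 * q * q := hq ▸ algebraMap_one_half A
  have a4 : algebraMap ℂ A (1 / 4) = 2 * q * q := hq ▸ algebraMap_one_quarter A
  have ab : algebraMap ℂ A (β / 8) = q * q * algebraMap ℂ A β := by
    rw [hq, ← map_mul, ← map_mul]
    congr 1
    linear_combination -(β / 16) * rt_mul_rt
  have ad : algebraMap ℂ A (δ / rt) = 2 * q * algebraMap ℂ A δ := by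
    rw [hq, ← map_ofNat (algebraMap ℂ A) 2, ← map_mul, ← map_mul]
    congr 1
    field_simp [rt_ne_zero]
    linear_combination -(2 * δ) * rt_mul_rt
  have an : algebraMap ℂ A ((ω / √2 : ℝ) * Complex.I) = 2 * q * algebraMap ℂ A ω * J := by
    rw [hq, hJ, ← map_ofNat (algebraMap ℂ A) 2, ← map_mul, ← map_mul, ← map_mul]
    congr 1
    push_cast
    change ω / rt * Complex.I = _
    field_simp [rt_ne_zero]
    linear_combination -(2 * ω) * rt_mul_rt
  simp only [JetCurve.flow, T.S_d, T.S_x, Chart.straightD, Chart.straightX, Chart.duffing,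
    Matrix.cons_val, Derivation.smul_apply, Derivation.add_apply, Derivation.sub_apply,
    smul_eq_mul, Algebra.smul_def (R := ℂ), map_mul, map_ofNat, ← hq, ← hJ, a1, a2, a4, ab, ad, an]
  have e1 : 4 * q * q * (T.X 0 + 1) - 4 * q * q * (T.X 0 + 1) * (4 * q * q * (T.X 0 + 1))
      + (q * T.X 1 - 2 * q * q * (1 - T.X 0 * T.X 0)) = q * T.X 1 := by
    linear_combination -2 * q * q * (T.X 0 + 1) ^ 2 * h8
  have e2 : 2 * (4 * q * q * (T.X 0 + 1)) - 1 = T.X 0 := by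
    linear_combination (T.X 0 + 1) * h8
  linear_combination 8 * q * (T.D 0 φ - 4 * q * T.X 0 * T.D 1 φ) * e1
    + 32 * q * q * (q * T.X 1 - 2 * q * q * (1 - T.X 0 * T.X 0)) * T.D 1 φ * e2
    - 64 * q ^ 3 * algebraMap ℂ A δ * T.X 2 * T.D 1 φ * e1
    + (T.X 1 * T.D 0 φ + (8 * q * q + 1) * (-T.X 0 * (1 - T.X 0 * T.X 0) * T.D 1 φ
      + algebraMap ℂ A β * T.X 3 * T.D 1 φ - algebraMap ℂ A δ * T.X 2 * T.X 1 * T.D 1 φ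
      - algebraMap ℂ A ω * (T.X 4 * T.D 3 φ - T.X 3 * T.D 4 φ))) * h8
    + 64 * q ^ 4 * algebraMap ℂ A ω * (T.X 4 * T.D 3 φ - T.X 3 * T.D 4 φ) * hJ2

end DuffingChart

namespace Chart

variable {A : Type*} [CommRing A] [Algebra ℂ A] (T : Chart A)

lemma duffing_apply (β δ ω : ℂ) (φ : A) :
    T.duffing β δ ω φ = T.X 1 * T.D 0 φ
      + (-T.X 0 + T.X 0 ^ 3 - δ • (T.X 2 * T.X 1) + β • T.X 3) * T.D 1 φ
      - (ω • T.X 4) * T.D 3 φ + (ω • T.X 3) * T.D 4 φ := by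
  simp [duffing]

lemma duffing_X_zero (β δ ω : ℂ) : T.duffing β δ ω (T.X 0) = T.X 1 := by
  simp [duffing_apply, T.D_X]

lemma duffing_X_three (β δ ω : ℂ) : T.duffing β δ ω (T.X 3) = -(ω • T.X 4) := by
  simp [duffing_apply, T.D_X]

lemma duffing_X_four (β δ ω : ℂ) : T.duffing β δ ω (T.X 4) = ω • T.X 3 := by
  simp [duffing_apply, T.D_X]

end Chart

namespace DuffingChart

variable {A : Type*} [CommRing A] [Algebra ℂ A] (T : DuffingChart A)

/-- The variational equation along the Duffing flow has no nonzero solutions. -/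
theorem variational_eq_zero {β δ : ℂ} {ω : ℝ} (hβ : β ≠ 0) (hω : ω ≠ 0) {a b : A} {lam₁ lam₂ : ℂ}
    (ha : T.duffing β δ ω a = b + lam₁ • (T.X 2 * a))
    (hb : T.duffing β δ ω b = (-1 + 3 * T.X 0 ^ 2) * a + lam₂ • (T.X 2 * b)) :
    a = 0 ∧ b = 0 := by
  obtain ⟨q, hq⟩ : ∃ q : A, q = algebraMap ℂ A (rt / 4) := ⟨_, rfl⟩
  have h8 : 8 * q * q = 1 := hq ▸ eight_mul_algebraMap_rt_sq A
  have a1 : algebraMap ℂ A rt = 4 * q := hq ▸ algebraMap_rt A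
  have a2 : algebraMap ℂ A (1 / 2) = 4 * q * q := hq ▸ algebraMap_one_half A
  have a4 : algebraMap ℂ A (1 / 4) = 2 * q * q := hq ▸ algebraMap_one_quarter A
  have hflow (φ : A) : T.S.flow (ω / √2) (β / 8) (δ / rt) φ = 2 * q * T.duffing β δ ω φ := by
    have := T.smul_flow β δ ω φ
    rw [Algebra.smul_def, a1] at this
    linear_combination 2 * q * this - T.S.flow (ω / √2) (β / 8) (δ / rt) φ * h8
  have key := T.S.jet_eq_zero_of_flow (ν := ω / √2) (b := β / 8) (δ := δ / rt)
    (a := (1 / 2 : ℂ) • a) (c := (rt / 4) • b + (1 / 2 : ℂ) • (T.X 0 * a))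
    (lam₁ := (rt / 4) * (2 * lam₁)) (lam₂ := (rt / 4) * (2 * lam₂))
    (lam₃ := (rt / 4) * (2 * (lam₂ - lam₁))) (lam₄ := (rt / 4) * (4 * (lam₁ - lam₂)))
    (by positivity) (by simpa using hβ) ?_ ?_
  · have h1 := T.eq_zero_of_mem_flat (φ := (1 / 2 : ℂ) • a) key.1
    have h2 := T.eq_zero_of_mem_flat (φ := (rt / 4) • b + (1 / 2 : ℂ) • (T.X 0 * a)) key.2
    have h3 : a = 0 := (smul_eq_zero_iff_right (by norm_num)).1 h1
    rw [h3, mul_zero, smul_zero, add_zero] at h2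
    exact ⟨h3, (smul_eq_zero_iff_right (div_ne_zero rt_ne_zero (by norm_num))).1 h2⟩
  · rw [hflow, Derivation.map_smul, ha]
    simp only [T.S_x, Chart.straightX, Matrix.cons_val, Algebra.smul_def, map_mul,
      map_ofNat, ← hq, a2]
    linear_combination (q * b + 4 * q * q * (T.X 0 + 1) * a) * h8
  · have e2 : 2 * (4 * q * q * (T.X 0 + 1)) - 1 = T.X 0 := by
      linear_combination (T.X 0 + 1) * h8
    rw [hflow, map_add, Derivation.map_smul, Derivation.map_smul, Derivation.leibniz, ha, hb, T.duffing_X_zero]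
    simp only [smul_eq_mul, T.S_x, Chart.straightX, Matrix.cons_val, Algebra.smul_def, map_mul,
      map_sub, map_ofNat, ← hq, a2, a4]
    linear_combination -(q * b + 4 * q * q * (T.X 0 * a)) * e2
      - 8 * q ^ 3 * T.X 2 * (algebraMap ℂ A lam₁ - algebraMap ℂ A lam₂) * a * e2
      + (2 * q * q * a - 2 * q * q * T.X 0 ^ 2 * a + q * T.X 0 * b) * h8

end DuffingChart

namespace Chart

variable {A : Type*} [CommRing A] [Algebra ℂ A] (T : Chart A)

/-- The components of a vector field commuting with the Duffing field. -/
structure IsSymmetry (β δ ω : ℂ) (g : Fin 5 → A) : Prop where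
  zero : T.duffing β δ ω (g 0) = g 1
  one : T.duffing β δ ω (g 1) = (-1 + 3 * T.X 0 ^ 2) * g 0 - δ • (T.X 2 * g 1)
    - δ • (T.X 1 * g 2) + β • g 3
  two : T.duffing β δ ω (g 2) = 0
  three : T.duffing β δ ω (g 3) = -(ω • g 4)
  four : T.duffing β δ ω (g 4) = ω • g 3

variable {T} {β δ ω : ℂ}

lemma IsSymmetry.sum_mul {ι : Type*} [Fintype ι] {g : ι → Fin 5 → A}
    (hg : ∀ j, T.IsSymmetry β δ ω (g j)) {c : ι → A} (hc : ∀ j, T.duffing β δ ω (c j) = 0) :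
    T.IsSymmetry β δ ω (fun i => ∑ j, c j * g j i) := by
  have h (i : Fin 5) : T.duffing β δ ω (∑ j, c j * g j i) = ∑ j, c j * T.duffing β δ ω (g j i) := by
    rw [map_sum]
    exact Finset.sum_congr rfl fun j _ => by simp [Derivation.leibniz, hc]
  constructor
  · simp only [h, (hg _).zero]
  · rw [h]
    simp only [(hg _).one, Finset.mul_sum, Finset.smul_sum, ← Finset.sum_add_distrib,
      ← Finset.sum_sub_distrib]
    refine Finset.sum_congr rfl fun j _ => ?_
    simp only [Algebra.smul_def]
    ring
  · simp only [h, (hg _).two, mul_zero, Finset.sum_const_zero]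
  · simp only [h, (hg _).three, Finset.smul_sum, ← Finset.sum_neg_distrib]
    exact Finset.sum_congr rfl fun j _ => by simp
  · simp only [h, (hg _).four, Finset.smul_sum]
    exact Finset.sum_congr rfl fun j _ => by simp

/-- The radial component of a field in the plane of the forcing variables. -/
def radial (T : Chart A) (g : Fin 5 → A) : A := T.X 3 * g 3 + T.X 4 * g 4

/-- The angular component of a field in the plane of the forcing variables. -/
def angular (T : Chart A) (g : Fin 5 → A) : A := T.X 3 * g 4 - T.X 4 * g 3

lemma IsSymmetry.duffing_radial {g : Fin 5 → A} (hg : T.IsSymmetry β δ ω g) :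
    T.duffing β δ ω (T.radial g) = 0 := by
  simp only [radial, map_add, Derivation.leibniz, hg.three, hg.four, T.duffing_X_three,
    T.duffing_X_four, smul_eq_mul, Algebra.smul_def]
  ring

lemma IsSymmetry.duffing_angular {g : Fin 5 → A} (hg : T.IsSymmetry β δ ω g) :
    T.duffing β δ ω (T.angular g) = 0 := by
  simp only [angular, map_sub, Derivation.leibniz, hg.three, hg.four, T.duffing_X_three,
    T.duffing_X_four, smul_eq_mul, Algebra.smul_def]
  ring

lemma radius_ne_zero [Nontrivial A] (T : Chart A) : T.X 3 * T.X 3 + T.X 4 * T.X 4 ≠ 0 := by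
  intro h
  have h1 : T.D 3 (T.D 3 (T.X 3 * T.X 3 + T.X 4 * T.X 4)) = 0 := by simp [h]
  have h2 : (2 : A) = 0 := by
    rw [← h1]
    simp [Derivation.leibniz, T.D_X]
    norm_num
  have h3 : algebraMap ℂ A 2 ≠ 0 := (map_ne_zero_iff _ (algebraMap ℂ A).injective).2 two_ne_zero
  exact h3 (by rw [map_ofNat, h2])

/-- First integrals of the Duffing field. -/
def constants (T : Chart A) (β δ ω : ℂ) : Subalgebra ℂ A where
  carrier := {φ | T.duffing β δ ω φ = 0}
  mul_mem' := by
    intro φ ψ hφ hψ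
    simp only [Set.mem_ofPred_eq] at *
    simp [Derivation.leibniz, hφ, hψ]
  add_mem' := by
    intro φ ψ hφ hψ
    simp only [Set.mem_ofPred_eq] at *
    simp [hφ, hψ]
  algebraMap_mem' c := by simp

lemma exists_relation [IsDomain A] {q n : ℕ} (hn : n < q) (v : Fin q → Fin n → A)
    (hv : ∀ j i, T.duffing β δ ω (v j i) = 0) :
    ∃ c : Fin q → A, (∀ j, T.duffing β δ ω (c j) = 0) ∧ c ≠ 0 ∧ ∀ i, ∑ j, c j * v j i = 0 := by
  let w : Fin q → Fin n → T.constants β δ ω := fun j i => ⟨v j i, hv j i⟩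
  have hw : ¬ LinearIndependent (T.constants β δ ω) w := fun h => by
    have := h.fintype_card_le_finrank
    simp at this
    omega
  obtain ⟨c, hc, j, hj⟩ := Fintype.not_linearIndependent_iff.1 hw
  refine ⟨fun j => c j, fun j => (c j).2, fun h => hj (Subtype.ext (congrFun h j)), fun i => ?_⟩
  have := congrArg Subtype.val (congrFun hc i)
  simpa [w] using this

end Chart

namespace DuffingChart

variable {A : Type*} [CommRing A] [Algebra ℂ A] (T : DuffingChart A)
  {β δ : ℂ} {ω : ℝ}

lemma D_zero_one_eq_zero (hβ : β ≠ 0) (hω : ω ≠ 0) {F : A} (hF : T.duffing β δ ω F = 0) :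
    T.D 0 F = 0 ∧ T.D 1 F = 0 := by
  have h0 : T.D 0 (T.duffing β δ ω F) = 0 := by rw [hF, map_zero]
  have h1 : T.D 1 (T.duffing β δ ω F) = 0 := by rw [hF, map_zero]
  rw [Chart.duffing_apply] at h0 h1
  simp only [map_add, map_sub, map_neg, Derivation.leibniz, Derivation.leibniz_pow,
    Derivation.map_smul, T.D_X, smul_eq_mul] at h0 h1
  have c (i j : Fin 5) := T.comm i j F
  simp [c 1 0, Algebra.smul_def] at h0 h1
  obtain ⟨ha, hb⟩ := T.variational_eq_zero (δ := δ) hβ hω (a := T.D 1 F) (b := -T.D 0 F)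
    (lam₁ := δ) (lam₂ := 0)
    (by
      rw [Chart.duffing_apply, ← c 1 3, ← c 1 4]
      simp only [Algebra.smul_def]
      linear_combination h1) (by
      rw [map_neg, Chart.duffing_apply, ← c 0 3, ← c 0 4, ← c 0 1]
      simp only [Algebra.smul_def, map_zero]
      linear_combination -h0)
  exact ⟨neg_eq_zero.1 hb, ha⟩

variable [IsDomain A]

lemma eq_zero_of_isSymmetry (hβ : β ≠ 0) (hω : ω ≠ 0) {g : Fin 5 → A}
    (hg : T.IsSymmetry β δ ω g) (h2 : g 2 = 0) (hr : T.radial g = 0) (ha : T.angular g = 0) :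
    g = 0 := by
  rw [Chart.radial] at hr
  rw [Chart.angular] at ha
  have h3 : g 3 = 0 := (mul_eq_zero.1 (show (T.X 3 * T.X 3 + T.X 4 * T.X 4) * g 3 = 0 by
    linear_combination T.X 3 * hr - T.X 4 * ha)).resolve_left T.radius_ne_zero
  have h4 : g 4 = 0 := (mul_eq_zero.1 (show (T.X 3 * T.X 3 + T.X 4 * T.X 4) * g 4 = 0 by
    linear_combination T.X 4 * hr + T.X 3 * ha)).resolve_left T.radius_ne_zero
  obtain ⟨h0, h1⟩ := T.variational_eq_zero hβ hω (a := g 0) (b := g 1) (lam₁ := 0) (lam₂ := -δ)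
    (by rw [hg.zero]; simp) (by rw [hg.one, h2, h3]; simp [sub_eq_add_neg])
  funext i
  fin_cases i
  exacts [h0, h1, h2, h3, h4]

lemma angular_gradient_eq_zero (hβ : β ≠ 0) (hω : ω ≠ 0) {F : A}
    (hF : T.duffing β δ ω F = 0) : T.angular (fun i => T.D i F) = 0 := by
  obtain ⟨h0, h1⟩ := T.D_zero_one_eq_zero hβ hω hF
  rw [Chart.duffing_apply, h0, h1] at hF
  have h : (ω : ℂ) • T.angular (fun i => T.D i F) = 0 := by
    rw [← hF]
    simp only [Chart.angular, Algebra.smul_def]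
    ring
  exact (smul_eq_zero_iff_right (Complex.ofReal_ne_zero.2 hω)).1 h

/-- Independent first integrals are already independent in the variables `ε` and `u₁² + u₂²`. -/
lemma linearIndependent_radial (hβ : β ≠ 0) (hω : ω ≠ 0) {m : ℕ} {F : Fin m → A}
    (hF : ∀ k, T.duffing β δ ω (F k) = 0)
    (hdF : LinearIndependent A (fun k i => T.D i (F k))) :
    LinearIndependent A (fun k => ![T.D 2 (F k), T.radial (fun i => T.D i (F k))]) := by
  rw [Fintype.linearIndependent_iff] at hdF ⊢
  intro c hc k
  have hc2 := congrFun hc 0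
  have hcr := congrFun hc 1
  simp only [Finset.sum_apply, Pi.smul_apply, Matrix.cons_val, smul_eq_mul, Pi.zero_apply] at hc2 hcr
  have h := hdF (fun k => (T.X 3 * T.X 3 + T.X 4 * T.X 4) * c k) ?_ k
  · exact (mul_eq_zero.1 h).resolve_left T.radius_ne_zero
  have ha (k) : T.X 3 * T.D 4 (F k) - T.X 4 * T.D 3 (F k) = 0 :=
    T.angular_gradient_eq_zero hβ hω (hF k)
  funext i
  simp only [Finset.sum_apply, Pi.smul_apply, smul_eq_mul, Pi.zero_apply]
  fin_cases i
  · simp [(T.D_zero_one_eq_zero hβ hω (hF _)).1]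
  · simp [(T.D_zero_one_eq_zero hβ hω (hF _)).2]
  · simp only [mul_assoc, ← Finset.mul_sum]
    exact mul_eq_zero_of_right _ hc2
  · calc ∑ k, (T.X 3 * T.X 3 + T.X 4 * T.X 4) * c k * T.D 3 (F k)
        = ∑ k, T.X 3 * (c k * T.radial (fun i => T.D i (F k))) :=
          Finset.sum_congr rfl fun k _ => by
            rw [Chart.radial]; linear_combination -T.X 4 * c k * ha k
      _ = 0 := by rw [← Finset.mul_sum, hcr, mul_zero]
  · calc ∑ k, (T.X 3 * T.X 3 + T.X 4 * T.X 4) * c k * T.D 4 (F k)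
        = ∑ k, T.X 4 * (c k * T.radial (fun i => T.D i (F k))) :=
          Finset.sum_congr rfl fun k _ => by
            rw [Chart.radial]; linear_combination T.X 3 * c k * ha k
      _ = 0 := by rw [← Finset.mul_sum, hcr, mul_zero]

/-- A field annihilating two independent first integrals has no `ε` and radial components. -/
lemma radial_eq_zero (hβ : β ≠ 0) (hω : ω ≠ 0) {F : Fin 2 → A}
    (hF : ∀ k, T.duffing β δ ω (F k) = 0)
    (hdF : LinearIndependent A (fun k i => T.D i (F k))) {g : Fin 5 → A}
    (hFg : ∀ k, ∑ i, g i * T.D i (F k) = 0) : g 2 = 0 ∧ T.radial g = 0 := by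
  have hlin := T.linearIndependent_radial hβ hω hF hdF
  let M : Matrix (Fin 2) (Fin 2) A :=
    fun k => ![T.D 2 (F k), T.radial (fun i => T.D i (F k))]
  have hM : M.det ≠ 0 := fun h => by
    obtain ⟨v, hv, hvM⟩ := Matrix.exists_vecMul_eq_zero_iff.2 h
    refine hv (funext (Fintype.linearIndependent_iff.1 hlin v ?_))
    rw [← hvM]
    funext i
    fin_cases i <;> simp [Matrix.vecMul, dotProduct, M]
  have hv : ![(T.X 3 * T.X 3 + T.X 4 * T.X 4) * g 2, T.radial g] = 0 := by
    refine Matrix.eq_zero_of_mulVec_eq_zero hM ?_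
    funext k
    have ha : T.X 3 * T.D 4 (F k) - T.X 4 * T.D 3 (F k) = 0 :=
      T.angular_gradient_eq_zero hβ hω (hF k)
    have h := hFg k
    rw [Fin.sum_univ_five, (T.D_zero_one_eq_zero hβ hω (hF k)).1,
      (T.D_zero_one_eq_zero hβ hω (hF k)).2] at h
    simp only [Matrix.mulVec, dotProduct, M, Fin.sum_univ_two, Matrix.cons_val, Chart.radial,
      Pi.zero_apply]
    linear_combination (T.X 3 * T.X 3 + T.X 4 * T.X 4) * h
      + (T.X 4 * g 3 - T.X 3 * g 4) * ha
  exact ⟨(mul_eq_zero.1 (congrFun hv 0)).resolve_left T.radius_ne_zero, congrFun hv 1⟩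

/-- The Duffing field has no complete system of independent commuting fields and common first
integrals. -/
theorem not_integrable (hβ : β ≠ 0) (hω : ω ≠ 0) {q m : ℕ} (hqm : q + m = 5)
    {g : Fin q → Fin 5 → A} {F : Fin m → A} (hg : ∀ j, T.IsSymmetry β δ ω (g j))
    (hF : ∀ k, T.duffing β δ ω (F k) = 0) (hFg : ∀ k j, ∑ i, g j i * T.D i (F k) = 0)
    (hgi : LinearIndependent A g) (hdF : LinearIndependent A (fun k i => T.D i (F k))) :
    False := by
  have hm : m ≤ 2 := by
    simpa using (T.linearIndependent_radial hβ hω hF hdF).fintype_card_le_finrank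
  have key {c : Fin q → A} (hc : ∀ j, T.duffing β δ ω (c j) = 0) (hc0 : c ≠ 0)
      (h2 : ∑ j, c j * g j 2 = 0) (hr : ∑ j, c j * T.radial (g j) = 0)
      (ha : ∑ j, c j * T.angular (g j) = 0) : False := by
    have h := T.eq_zero_of_isSymmetry hβ hω (Chart.IsSymmetry.sum_mul hg hc) h2 ?_ ?_
    · refine hc0 (funext (Fintype.linearIndependent_iff.1 hgi c ?_))
      rw [← h]
      funext i
      simp
    · rw [← hr]
      simp only [Chart.radial, Finset.mul_sum, ← Finset.sum_add_distrib]
      exact Finset.sum_congr rfl fun j _ => by ring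
    · rw [← ha]
      simp only [Chart.angular, Finset.mul_sum, ← Finset.sum_sub_distrib]
      exact Finset.sum_congr rfl fun j _ => by ring
  by_cases hq : q = 3
  · obtain rfl : m = 2 := by omega
    have h (j) := T.radial_eq_zero hβ hω hF hdF (g := g j) (fun k => hFg k j)
    obtain ⟨c, hc, hc0, hrel⟩ := Chart.exists_relation (T := T.toChart) (by omega : 1 < q)
      (fun j => ![T.angular (g j)]) (fun j i => by
        fin_cases i
        exact (hg j).duffing_angular)
    exact key hc hc0 (by simp [(h _).1]) (by simp [(h _).2]) (hrel 0)
  · obtain ⟨c, hc, hc0, hrel⟩ := Chart.exists_relation (T := T.toChart) (by omega : 3 < q)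
      (fun j => ![g j 2, T.radial (g j), T.angular (g j)]) (fun j i => by
        fin_cases i
        exacts [(hg j).two, (hg j).duffing_radial, (hg j).duffing_angular])
    exact key hc hc0 (hrel 0) (hrel 1) (hrel 2)

end DuffingChart

namespace Duffing

open AnalyticAlgebra

variable {U : Opens (Fin 5 → ℝ)}

lemma analyticOnNhd_coord (i : Fin 5) :
    AnalyticOnNhd ℝ (fun x : Fin 5 → ℝ => (x i : ℂ)) (U : Set (Fin 5 → ℝ)) := fun x _ =>
  (Complex.ofRealCLM.analyticAt _).comp ((ContinuousLinearMap.proj (R := ℝ) i).analyticAt x)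

lemma hasFDerivAt_coord (i : Fin 5) (x : Fin 5 → ℝ) :
    HasFDerivAt (fun x : Fin 5 → ℝ => (x i : ℂ))
      (Complex.ofRealCLM.comp (ContinuousLinearMap.proj (R := ℝ) i)) x :=
  Complex.ofRealCLM.hasFDerivAt.comp x
    (ContinuousLinearMap.proj (R := ℝ) (φ := fun _ => ℝ) i).hasFDerivAt

/-- The standard coordinates on an open subset of `ℝ⁵`. -/
noncomputable def chart (U : Opens (Fin 5 → ℝ)) : Chart (AnalyticAlgebra U) where
  D i := dir (Pi.single i 1)
  X i := mk (fun x => (x i : ℂ)) (analyticOnNhd_coord i)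
  comm i j φ := dir_comm _ _ φ
  D_X i j := by
    refine ext_eq_iff.2 fun x => ?_
    rw [dir_mk, (hasFDerivAt_coord j _).fderiv]
    by_cases h : i = j
    · subst h; simp
    · simp [h]

lemma chart_X_apply (i : Fin 5) (x : U) :
    ((chart U).X i).1 x = ((x : Fin 5 → ℝ) i : ℂ) := rfl

lemma fderiv_eq_sum (φ : AnalyticAlgebra U) (x : U) (v : Fin 5 → ℝ) :
    fderiv ℝ (ext φ) x v = ∑ i, (v i : ℂ) * ((chart U).D i φ).1 x := by
  have h : v = ∑ i, v i • (Pi.single i 1 : Fin 5 → ℝ) := by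
    simpa using pi_eq_sum_univ' v
  conv_lhs => rw [h]
  simp only [map_sum, map_smul, Complex.real_smul]
  rfl

/-- The heteroclinic orbit. -/
noncomputable def curve (t : ℝ) : Fin 5 → ℝ := ![2 * t - 1, 2 * √2 * (t * (1 - t)), 0, 0, 0]

lemma hasDerivAt_curve (t : ℝ) :
    HasDerivAt curve ![2, 2 * √2 * (1 - 2 * t), 0, 0, 0] t := by
  rw [hasDerivAt_pi]
  intro i
  fin_cases i
  · simpa [curve] using ((hasDerivAt_id t).const_mul 2).sub_const 1
  · refine (((hasDerivAt_id t).mul ((hasDerivAt_id t).const_sub 1)).const_mul (2 * √2)).congr_deriv ?_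
    simp
    ring
  all_goals exact hasDerivAt_const _ _

lemma analyticAt_curve (t : ℝ) : AnalyticAt ℝ curve t := by
  rw [analyticAt_pi_iff]
  intro i
  fin_cases i
  · exact (analyticAt_const.mul analyticAt_id).sub analyticAt_const
  · exact analyticAt_const.mul (analyticAt_id.mul (analyticAt_const.sub analyticAt_id))
  all_goals exact analyticAt_const

open Classical in
/-- Evaluation at a point of the heteroclinic orbit, or at its midpoint if it is outside `U`. -/
noncomputable def evCurve (hmid : curve (1 / 2) ∈ U) (t : ℝ) : AnalyticAlgebra U →ₐ[ℂ] ℂ :=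
  (Pi.evalAlgHom ℂ (fun _ : U => ℂ)
    (if h : curve t ∈ U then ⟨curve t, h⟩ else ⟨_, hmid⟩)).comp (AnalyticAlgebra U).val

lemma evCurve_of_mem (hmid : curve (1 / 2) ∈ U) {t : ℝ} (h : curve t ∈ U) (φ : AnalyticAlgebra U) :
    evCurve hmid t φ = φ.1 ⟨curve t, h⟩ := by
  simp [evCurve, h]

lemma evCurve_eventuallyEq (hmid : curve (1 / 2) ∈ U) {t : ℝ} (h : curve t ∈ U)
    (φ : AnalyticAlgebra U) : (fun t => evCurve hmid t φ) =ᶠ[𝓝 t] fun t => ext φ (curve t) := by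
  filter_upwards [(analyticAt_curve t).continuousAt.preimage_mem_nhds (U.2.mem_nhds h)] with s hs
  rw [evCurve_of_mem hmid hs, ← ext_apply]

lemma evCurve_analyticAt (hmid : curve (1 / 2) ∈ U) {t : ℝ} (h : curve t ∈ U)
    (φ : AnalyticAlgebra U) : AnalyticAt ℝ (fun t => evCurve hmid t φ) t :=
  ((analyticOnNhd_ext φ _ h).comp (analyticAt_curve t)).congr (evCurve_eventuallyEq hmid h φ).symm

lemma evCurve_X (hmid : curve (1 / 2) ∈ U) {t : ℝ} (h : curve t ∈ U) (i : Fin 5) :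
    evCurve hmid t ((chart U).X i) = (curve t i : ℂ) := by
  rw [evCurve_of_mem hmid h, chart_X_apply]

lemma evCurve_hasDerivAt (hmid : curve (1 / 2) ∈ U) {t : ℝ} (h : curve t ∈ U)
    (φ : AnalyticAlgebra U) :
    HasDerivAt (fun t => evCurve hmid t φ) (evCurve hmid t ((chart U).straightD 0 φ)) t := by
  have h1 := ((differentiableAt_ext φ ⟨_, h⟩).hasFDerivAt.comp_hasDerivAt t
    (hasDerivAt_curve t)).congr_of_eventuallyEq (evCurve_eventuallyEq hmid h φ)
  refine h1.congr_deriv ?_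
  have hX := evCurve_X hmid h 0
  have h2 : (chart U).straightD 0 φ = (2 : ℂ) • ((chart U).D 0 φ
      - rt • ((chart U).X 0 * (chart U).D 1 φ)) := rfl
  rw [h2, map_smul, map_sub, map_smul, map_mul, hX, evCurve_of_mem hmid h, evCurve_of_mem hmid h]
  refine (fderiv_eq_sum φ ⟨_, h⟩ _).trans ?_
  simp [Fin.sum_univ_five, curve, rt]
  ring

/-- The straightening coordinates as a jet structure. -/
noncomputable def jetCurve (hcurve : ∀ t ∈ Set.Icc (0 : ℝ) 1, curve t ∈ U)
    (hmid : curve (1 / 2) ∈ U) : JetCurve (AnalyticAlgebra U) where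
  d := (chart U).straightD
  x := (chart U).straightX
  ev := evCurve hmid
  comm := (chart U).straightD_comm
  d_x := (chart U).straightD_straightX
  ev_zero t ht := by
    have hX := evCurve_X hmid (hcurve t (Set.Ioo_subset_Icc_self ht))
    simp [Chart.straightX, hX, curve]
    ring
  ev_ne_zero t ht i hi := by
    have hr := rt_mul_rt
    have hX := evCurve_X hmid (hcurve t (Set.Ioo_subset_Icc_self ht))
    fin_cases i
    · simp at hi
    · simp [Chart.straightX, hX, curve]
      change rt / 4 * (2 * rt * (t * (1 - t))) - _ = 0
      linear_combination (t * (1 - t) / 2) * hr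
    all_goals simp [Chart.straightX, hX, curve]
  analytic φ t ht := evCurve_analyticAt hmid (hcurve t ht) φ
  hasDerivAt φ t ht := evCurve_hasDerivAt hmid (hcurve t (Set.Ioo_subset_Icc_self ht)) φ

/-- The standard coordinates on a connected neighbourhood of the heteroclinic orbit. -/
noncomputable def duffingChart (hU : IsPreconnected (U : Set (Fin 5 → ℝ)))
    (hcurve : ∀ t ∈ Set.Icc (0 : ℝ) 1, curve t ∈ U) : DuffingChart (AnalyticAlgebra U) where
  toChart := chart U
  S := jetCurve hcurve (hcurve _ (by norm_num))
  S_d := rfl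
  S_x := rfl
  eq_zero_of_stable N hD hev φ hφ := by
    have hmid := hcurve (1 / 2) (by norm_num)
    refine AnalyticAlgebra.eq_zero_of_stable hU (P := (· ∈ N)) (x := ⟨_, hmid⟩) ?_ ?_ hφ
    · intro v ψ hψ
      have : dir v ψ = ∑ i, (v i : ℂ) • (chart U).D i ψ := by
        refine ext_eq_iff.2 fun x => ?_
        rw [dir_apply, fderiv_eq_sum]
        simp
      change dir v ψ ∈ N
      rw [this]
      exact N.sum_mem fun i _ => N.smul_mem _ (hD i ψ hψ)
    · intro ψ hψ
      rw [← evCurve_of_mem hmid hmid]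
      exact hev ψ hψ

end Duffing

namespace Duffing

open AnalyticAlgebra

variable {U : Opens (Fin 5 → ℝ)}

lemma curve_mem_heteroclinicSet {t : ℝ} (ht : t ∈ Set.Icc (0 : ℝ) 1) :
    curve t ∈ heteroclinicSet := by
  rcases ht.1.eq_or_lt with rfl | h0
  · right; left; simp [curve]
  rcases ht.2.eq_or_lt with rfl | h1
  · right; right; norm_num [curve]
  left
  have hx : 2 * t - 1 ∈ Set.Ioo (-1 : ℝ) 1 := ⟨by linarith, by linarith⟩
  have hs : √2 * √2 = 2 := Real.mul_self_sqrt (by norm_num)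
  have hs0 : √2 ≠ 0 := by positivity
  refine ⟨√2 * Real.artanh (2 * t - 1), ?_⟩
  simp only [mul_div_cancel_left₀ _ hs0, Real.tanh_artanh hx, Real.cosh_artanh hx, curve]
  congr 2
  have hp : 0 ≤ 1 - (2 * t - 1) ^ 2 := by nlinarith
  rw [one_div, inv_inv, Real.sq_sqrt hp]
  field_simp
  linear_combination (-2 * t * (1 - t)) * hs

lemma isPreconnected_curve : IsPreconnected (curve '' Set.Icc 0 1) :=
  isPreconnected_Icc.image _ fun t _ => (analyticAt_curve t).continuousAt.continuousWithinAt

lemma analyticOnNhd_ofReal {Φ : (Fin 5 → ℝ) → ℝ} {s : Set (Fin 5 → ℝ)}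
    (h : AnalyticOnNhd ℝ Φ s) : AnalyticOnNhd ℝ (fun x => (Φ x : ℂ)) s := fun x hx =>
  (Complex.ofRealCLM.analyticAt _).comp (h x hx)

/-- A real-valued analytic function as an element of the algebra. -/
noncomputable def ofReal (Φ : (Fin 5 → ℝ) → ℝ) (h : AnalyticOnNhd ℝ Φ U) : AnalyticAlgebra U :=
  mk (fun x => (Φ x : ℂ)) (analyticOnNhd_ofReal h)

lemma ofReal_apply (Φ : (Fin 5 → ℝ) → ℝ) (h : AnalyticOnNhd ℝ Φ U) (x : U) :
    (ofReal Φ h).1 x = (Φ x : ℂ) := rfl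

lemma fderiv_ofReal (Φ : (Fin 5 → ℝ) → ℝ) (h : AnalyticOnNhd ℝ Φ U) (x : U) (v : Fin 5 → ℝ) :
    fderiv ℝ (ext (ofReal Φ h)) x v = (fderiv ℝ Φ x v : ℂ) := by
  have h1 : HasFDerivAt (fun x => (Φ x : ℂ)) (Complex.ofRealCLM.comp (fderiv ℝ Φ x))
      (x : Fin 5 → ℝ) :=
    Complex.ofRealCLM.hasFDerivAt.comp _ (h x x.2).differentiableAt.hasFDerivAt
  rw [ofReal, (ext_mk _ _ x).fderiv_eq, h1.fderiv]
  rfl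

lemma chart_D_ofReal (Φ : (Fin 5 → ℝ) → ℝ) (h : AnalyticOnNhd ℝ Φ U) (i : Fin 5) (x : U) :
    ((chart U).D i (ofReal Φ h)).1 x = (fderiv ℝ Φ x (Pi.single i 1) : ℂ) :=
  fderiv_ofReal Φ h x _

lemma duffing_apply (β δ ω : ℝ) (φ : AnalyticAlgebra U) (x : U) :
    ((chart U).duffing β δ ω φ).1 x = fderiv ℝ (ext φ) x (duffingField₂ β δ ω x) := by
  rw [fderiv_eq_sum, Fin.sum_univ_five, Chart.duffing_apply]
  simp [duffingField₂, chart_X_apply]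
  ring

lemma duffing_ofReal (β δ ω : ℝ) (Φ : (Fin 5 → ℝ) → ℝ) (h : AnalyticOnNhd ℝ Φ U) (x : U) :
    ((chart U).duffing β δ ω (ofReal Φ h)).1 x
      = (fderiv ℝ Φ x (duffingField₂ β δ ω x) : ℂ) := by
  rw [duffing_apply, fderiv_ofReal]

lemma fderiv_duffingField₂ (β δ ω : ℝ) (x v : Fin 5 → ℝ) :
    fderiv ℝ (duffingField₂ β δ ω) x v
      = ![v 1, (-1 + 3 * x 0 ^ 2) * v 0 - δ * (x 2 * v 1) - δ * (x 1 * v 2) + β * v 3, 0,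
        -(ω * v 4), ω * v 3] := by
  have hd : DifferentiableAt ℝ (duffingField₂ β δ ω) x := by
    rw [differentiableAt_pi]
    intro i
    fin_cases i <;> simp [duffingField₂] <;> fun_prop
  have h1 : HasDerivAt (fun t : ℝ => x + t • v) v 0 := by
    simpa using ((hasDerivAt_id (0 : ℝ)).smul_const v).const_add x
  have h2 : HasDerivAt (fun t : ℝ => duffingField₂ β δ ω (x + t • v))
      (fderiv ℝ (duffingField₂ β δ ω) x v) 0 := by
    have hd' : HasFDerivAt (duffingField₂ β δ ω) (fderiv ℝ (duffingField₂ β δ ω) x)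
        (x + (0 : ℝ) • v) := by
      rw [zero_smul, add_zero]
      exact hd.hasFDerivAt
    exact hd'.comp_hasDerivAt 0 h1
  refine h2.unique (hasDerivAt_pi.2 fun i => ?_)
  have hc (i : Fin 5) : HasDerivAt (fun t : ℝ => (x + t • v) i) (v i) 0 := hasDerivAt_pi.1 h1 i
  fin_cases i
  · exact hc 1
  · refine ((((hc 0).neg.add ((hc 0).pow 3)).sub (((hc 2).mul_const δ).mul (hc 1))).add
      ((hc 3).const_mul β)).congr_deriv ?_
    simp
    ring
  · exact hasDerivAt_const _ _
  · exact ((hc 4).const_mul ω).neg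
  · exact (hc 3).const_mul ω

lemma analyticOnNhd_component {f : (Fin 5 → ℝ) → Fin 5 → ℝ} {s : Set (Fin 5 → ℝ)}
    (hf : AnalyticOnNhd ℝ f s) (i : Fin 5) : AnalyticOnNhd ℝ (fun x => f x i) s := fun x hx =>
  analyticAt_pi_iff.1 (hf x hx) i

lemma fderiv_component {f : (Fin 5 → ℝ) → Fin 5 → ℝ} {x : Fin 5 → ℝ}
    (hf : DifferentiableAt ℝ f x) (i : Fin 5) (v : Fin 5 → ℝ) :
    fderiv ℝ (fun x => f x i) x v = fderiv ℝ f x v i := by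
  rw [(hasFDerivAt_pi'.1 hf.hasFDerivAt i).fderiv]
  rfl

lemma isSymmetry_of_commute {β δ ω : ℝ} {f : (Fin 5 → ℝ) → Fin 5 → ℝ}
    (hf : AnalyticOnNhd ℝ f U)
    (h : ∀ x ∈ U, fderiv ℝ f x (duffingField₂ β δ ω x) = fderiv ℝ (duffingField₂ β δ ω) x (f x)) :
    (chart U).IsSymmetry β δ ω (fun i => ofReal (fun x => f x i) (analyticOnNhd_component hf i)) := by
  have key (i : Fin 5) (x : U) : ((chart U).duffing β δ ω
      (ofReal (fun x => f x i) (analyticOnNhd_component hf i))).1 x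
        = (fderiv ℝ (duffingField₂ β δ ω) x (f x) i : ℂ) := by
    rw [duffing_ofReal, fderiv_component (hf x x.2).differentiableAt, h x x.2]
  constructor <;> refine ext_eq_iff.2 fun x => ?_ <;> rw [key, fderiv_duffingField₂] <;>
    simp [ofReal_apply, chart_X_apply]
  exact Or.inl (Or.inl rfl)

lemma linearIndependent_of_ae {q : ℕ} {v : Fin q → (Fin 5 → ℝ) → Fin 5 → ℝ}
    {w : Fin q → Fin 5 → AnalyticAlgebra U} (hw : ∀ j i (x : U), (w j i).1 x = (v j x i : ℂ))
    (hv : ∀ᵐ x ∂(volume.restrict (U : Set (Fin 5 → ℝ))), LinearIndependent ℝ (fun j => v j x)) :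
    LinearIndependent (AnalyticAlgebra U) w := by
  rw [Fintype.linearIndependent_iff]
  intro c hc j
  have h0 : Set.EqOn (ext (c j)) 0 U := by
    refine Measure.eqOn_open_of_ae_eq (μ := volume) ?_ U.2
      (analyticOnNhd_ext (c j)).continuousOn continuousOn_const
    filter_upwards [hv, ae_restrict_mem U.2.measurableSet] with x hx hxU
    have hsum (i : Fin 5) : ∑ j, (c j).1 ⟨x, hxU⟩ * (v j x i : ℂ) = 0 := by
      have := congrArg (fun φ : AnalyticAlgebra U => φ.1 ⟨x, hxU⟩) (congrFun hc i)
      simpa [hw] using this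
    rw [Fintype.linearIndependent_iff] at hx
    have hre := hx (fun j => ((c j).1 ⟨x, hxU⟩).re) (by
      funext i
      simpa using congrArg Complex.re (hsum i)) j
    have him := hx (fun j => ((c j).1 ⟨x, hxU⟩).im) (by
      funext i
      simpa using congrArg Complex.im (hsum i)) j
    rw [show ext (c j) x = (c j).1 ⟨x, hxU⟩ from ext_apply (c j) ⟨x, hxU⟩]
    exact Complex.ext hre him
  refine ext_eq_iff.2 fun x => ?_
  rw [← ext_apply]
  exact h0 x.2

lemma linearIndependent_apply_single {m : ℕ} {l : Fin m → (Fin 5 → ℝ) →L[ℝ] ℝ}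
    (hl : LinearIndependent ℝ l) :
    LinearIndependent ℝ (fun k i => l k (Pi.single i 1)) := by
  rw [Fintype.linearIndependent_iff] at hl ⊢
  intro c hc
  refine hl c (ContinuousLinearMap.coe_injective (LinearMap.pi_ext' fun i => LinearMap.ext_ring ?_))
  simpa using congrFun hc i

/-- The Duffing field is not integrable on a connected neighbourhood of the heteroclinic orbit. -/
theorem not_bogoyavlenskijIntegrable {β δ ω : ℝ} (hβ : β ≠ 0) (hω : ω ≠ 0)
    (hU : IsPreconnected (U : Set (Fin 5 → ℝ))) (hcurve : ∀ t ∈ Set.Icc (0 : ℝ) 1, curve t ∈ U)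
    {q m : ℕ} (hq : 1 ≤ q) (hqm : q + m = 5) :
    ¬ BogoyavlenskijIntegrable (duffingField₂ β δ ω) U q m := by
  rintro ⟨fs, Fs, hf, hfs, hFs, hcomm, hfi, hFi, hFf⟩
  have hzero := hcurve 0 (by norm_num)
  have : Nontrivial (AnalyticAlgebra U) :=
    ⟨0, 1, fun h => zero_ne_one (congrArg (fun φ : AnalyticAlgebra U => φ.1 ⟨_, hzero⟩) h)⟩
  have : NoZeroDivisors (AnalyticAlgebra U) := ⟨fun h => AnalyticAlgebra.eq_zero_or_eq_zero hU h⟩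
  have : IsDomain (AnalyticAlgebra U) := NoZeroDivisors.to_isDomain _
  refine DuffingChart.not_integrable (duffingChart hU hcurve) (β := β) (δ := δ) (ω := ω)
    (Complex.ofReal_ne_zero.2 hβ) hω hqm
    (g := fun j i => ofReal (fun x => fs j x i) (analyticOnNhd_component (hfs j) i))
    (F := fun k => ofReal (Fs k) (hFs k)) ?_ ?_ ?_ ?_ ?_
  · intro j
    refine isSymmetry_of_commute (hfs j) fun x hx => ?_
    have h1 := sub_eq_zero.1 (hcomm ⟨0, hq⟩ j x hx)
    have h2 : fs ⟨0, hq⟩ =ᶠ[𝓝 x] duffingField₂ β δ ω := by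
      filter_upwards [U.2.mem_nhds hx] with y hy using hf hq y hy
    rwa [h2.fderiv_eq, hf hq x hx] at h1
  · intro k
    refine ext_eq_iff.2 fun x => (duffing_ofReal β δ ω (Fs k) (hFs k) x).trans ?_
    rw [← hf hq x x.2, hFf k _ x x.2]
    simp
  · intro k j
    refine ext_eq_iff.2 fun x => ?_
    have h := fderiv_eq_sum (ofReal (Fs k) (hFs k)) x (fs j x)
    rw [fderiv_ofReal, hFf k j x x.2] at h
    simp only [AddSubmonoidClass.coe_finsetSum, Finset.sum_apply]
    exact h.symm
  · exact linearIndependent_of_ae (fun _ _ _ => rfl) hfi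
  · refine linearIndependent_of_ae (v := fun k x i => fderiv ℝ (Fs k) x (Pi.single i 1))
      (fun k i x => chart_D_ofReal (Fs k) (hFs k) i x) ?_
    filter_upwards [hFi] with x hx using linearIndependent_apply_single hx

end Duffing

theorem BogoyavlenskijIntegrable.mono {E : Type*} [NormedAddCommGroup E] [NormedSpace ℝ E]
    [MeasureSpace E] {f : E → E} {U V : Set E} {q m : ℕ} (h : BogoyavlenskijIntegrable f U q m)
    (hVU : V ⊆ U) : BogoyavlenskijIntegrable f V q m := by
  obtain ⟨fs, Fs, hf, hfs, hFs, hcomm, hfi, hFi, hFf⟩ := h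
  exact ⟨fs, Fs, fun h x hx => hf h x (hVU hx), fun j => (hfs j).mono hVU,
    fun k => (hFs k).mono hVU, fun j k x hx => hcomm j k x (hVU hx),
    ae_restrict_of_ae_restrict_of_subset hVU hfi, ae_restrict_of_ae_restrict_of_subset hVU hFi,
    fun k j x hx => hFf k j x (hVU hx)⟩

/-- If `β ≠ 0`, then the autonomous Duffing system
`ẋ₁ = x₂, ẋ₂ = −x₁ + x₁³ − εδx₂ + βu₁, ε̇ = 0, u̇₁ = −ωu₂, u̇₂ = ωu₁` is not
`(q, 5−q)`-integrable in the Bogoyavlenskij sense with real-analytic data on any open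
neighborhood `U` of `Γ̂`, for any `1 ≤ q ≤ 5`. -/
theorem duffing_heteroclinic_nonintegrable (β δ ω : ℝ)
    (hβpos : 0 < β) (hω : 0 < ω) (hδ : 0 ≤ δ) (hβ : β ≠ 0) :
    ∀ U : Set (Fin 5 → ℝ), IsOpen U → heteroclinicSet ⊆ U →
      ∀ q : ℕ, 1 ≤ q → q ≤ 5 →
        ¬ BogoyavlenskijIntegrable (duffingField₂ β δ ω) U q (5 - q) := by
  intro U hU hΓ q hq hq5 hI
  have himage : Duffing.curve '' Set.Icc 0 1 ⊆ U := by
    rintro _ ⟨t, ht, rfl⟩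
    exact hΓ (Duffing.curve_mem_heteroclinicSet ht)
  have hmid : Duffing.curve (1 / 2) ∈ Duffing.curve '' Set.Icc 0 1 := ⟨_, by norm_num, rfl⟩
  refine Duffing.not_bogoyavlenskijIntegrable
    (U := ⟨connectedComponentIn U (Duffing.curve (1 / 2)), hU.connectedComponentIn⟩)
    hβ hω.ne' isPreconnected_connectedComponentIn (fun t ht => ?_) hq (by omega)
    (hI.mono (connectedComponentIn_subset _ _))
  exact Duffing.isPreconnected_curve.subset_connectedComponentIn hmid himage ⟨t, ht, rfl⟩
end

section
/- For all θ ∈ ℝ, M(θ) = √2 π β ω sech(πω/2) sin θ − 4δ/3. In particular, if β ≠ 0 then M is not a constant function of θ. -/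
open MeasureTheory Filter Topology

theorem continuous_inv_cosh : Continuous fun t : ℝ => (Real.cosh t)⁻¹ :=
  Real.continuous_cosh.inv₀ fun t => ne_of_gt (Real.cosh_pos t)

/-- The hyperbolic secant is integrable on the real line. -/
theorem integrable_inv_cosh : Integrable fun t : ℝ => (Real.cosh t)⁻¹ := by
  refine (integrable_inv_one_add_sq.const_mul 4).mono'
    continuous_inv_cosh.aestronglyMeasurable
    (Eventually.of_forall fun t => ?_)
  have hquad := Real.quadratic_le_exp_of_nonneg (abs_nonneg t)
  have hcosh : Real.exp |t| / 2 ≤ Real.cosh t := by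
    rw [← Real.cosh_abs, Real.cosh_eq]
    linarith [Real.exp_pos (-|t|)]
  have hle : (1 + t ^ 2) / 4 ≤ Real.cosh t := by
    rw [sq_abs] at hquad
    linarith [abs_nonneg t, sq_nonneg t]
  rw [Real.norm_of_nonneg (inv_nonneg.2 (Real.cosh_pos t).le)]
  calc (Real.cosh t)⁻¹ ≤ ((1 + t ^ 2) / 4)⁻¹ := by gcongr
    _ = 4 * (1 + t ^ 2)⁻¹ := by rw [inv_div, div_eq_mul_inv]

/-- The product of the hyperbolic secant with a bounded continuous function is integrable. -/
theorem integrable_inv_cosh_mul {f : ℝ → ℝ} (hf : Continuous f) {C : ℝ} (hC : ∀ t, |f t| ≤ C) :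
    Integrable fun t => (Real.cosh t)⁻¹ * f t :=
  integrable_inv_cosh.mul_bdd hf.aestronglyMeasurable (Eventually.of_forall hC)

theorem one_sub_sigmoid_two_mul_mul_exp (t : ℝ) :
    (1 - Real.sigmoid (2 * t)) * Real.exp t = (2 * Real.cosh t)⁻¹ := by
  rw [← Real.sigmoid_neg, Real.sigmoid_def, Real.cosh_eq, neg_neg, two_mul t, Real.exp_add,
    Real.exp_neg]
  field_simp
  ring

/-- The substitution `x = σ(2t)` in the Beta integral. -/
theorem betaIntegral_integrand_sigmoid (ω t : ℝ) :
    |2 * (Real.sigmoid (2 * t) * (1 - Real.sigmoid (2 * t)))| •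
      (((Real.sigmoid (2 * t) : ℝ) : ℂ) ^ ((1 + ω * Complex.I) / 2 - 1) *
        (1 - ((Real.sigmoid (2 * t) : ℝ) : ℂ)) ^ ((1 - ω * Complex.I) / 2 - 1)) =
      ((Real.cosh t)⁻¹ : ℝ) * Complex.exp ((ω * t : ℝ) * Complex.I) := by
  have key := one_sub_sigmoid_two_mul_mul_exp t
  have hrefl := Real.sigmoid_mul_rexp_neg (2 * t)
  rw [Real.sigmoid_neg] at hrefl
  have hx := Real.sigmoid_pos (2 * t)
  have hx' := sub_pos.2 (Real.sigmoid_lt_one (2 * t))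
  generalize Real.sigmoid (2 * t) = x at *
  have hlog : Real.log (1 - x) = Real.log x - 2 * t := by
    rw [← hrefl, Real.log_mul hx.ne' (Real.exp_ne_zero _), Real.log_exp]
    ring
  have hcast : (1 - (x : ℂ)) = ((1 - x : ℝ) : ℂ) := by push_cast; rfl
  have hexp : Complex.exp (-(Real.log x : ℝ)) = ((x⁻¹ : ℝ) : ℂ) := by
    rw [← Complex.ofReal_neg, ← Complex.ofReal_exp, Real.exp_neg, Real.exp_log hx]
  have hcosh : (Real.cosh t)⁻¹ = 2 * (1 - x) * Real.exp t := by
    rw [mul_assoc, key, mul_inv]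
    ring
  rw [abs_of_pos (by positivity), hcast,
    Complex.cpow_def_of_ne_zero (Complex.ofReal_ne_zero.2 hx.ne'),
    Complex.cpow_def_of_ne_zero (Complex.ofReal_ne_zero.2 hx'.ne'), ← Complex.ofReal_log hx.le,
    ← Complex.ofReal_log hx'.le, hlog, ← Complex.exp_add, Complex.real_smul, hcosh]
  have harg : (Real.log x : ℂ) * ((1 + ω * Complex.I) / 2 - 1) +
      ((Real.log x - 2 * t : ℝ) : ℂ) * ((1 - ω * Complex.I) / 2 - 1) =
      -(Real.log x : ℝ) + ((t : ℝ) + (ω * t : ℝ) * Complex.I) := by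
    push_cast
    ring
  rw [harg, Complex.exp_add, Complex.exp_add, hexp]
  have hxc : (x : ℂ) ≠ 0 := Complex.ofReal_ne_zero.2 hx.ne'
  push_cast
  field_simp

/-- The Fourier transform of the hyperbolic secant. -/
theorem integral_inv_cosh_mul_cexp (ω : ℝ) :
    ∫ t : ℝ, ((Real.cosh t)⁻¹ : ℝ) * Complex.exp ((ω * t : ℝ) * Complex.I) =
      ((Real.pi * (Real.cosh (Real.pi * ω / 2))⁻¹ : ℝ) : ℂ) := by
  have hderiv : ∀ t : ℝ, HasDerivAt (fun s => Real.sigmoid (2 * s))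
      (2 * (Real.sigmoid (2 * t) * (1 - Real.sigmoid (2 * t)))) t := fun t =>
    ((Real.hasDerivAt_sigmoid (2 * t)).comp t ((hasDerivAt_id t).const_mul 2)).congr_deriv
      (by ring)
  have hinj : Function.Injective fun s : ℝ => Real.sigmoid (2 * s) :=
    Real.sigmoid_injective.comp (mul_right_injective₀ two_ne_zero)
  have himage : (fun s : ℝ => Real.sigmoid (2 * s)) '' Set.univ = Set.Ioo 0 1 := by
    rw [Set.image_univ, ← Real.range_sigmoid]
    exact (mul_left_surjective₀ (two_ne_zero' ℝ)).range_comp Real.sigmoid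
  have hsubst := integral_image_eq_integral_abs_deriv_smul MeasurableSet.univ
    (fun t _ => (hderiv t).hasDerivWithinAt) hinj.injOn
    (fun x : ℝ => (x : ℂ) ^ ((1 + ω * Complex.I) / 2 - 1) *
      (1 - (x : ℂ)) ^ ((1 - ω * Complex.I) / 2 - 1))
  rw [himage, ← integral_Ioc_eq_integral_Ioo, ← intervalIntegral.integral_of_le zero_le_one,
    ← Complex.betaIntegral, setIntegral_univ] at hsubst
  simp_rw [betaIntegral_integrand_sigmoid] at hsubst
  have hbeta := Complex.Gamma_mul_Gamma_eq_betaIntegral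
    (s := (1 + ω * Complex.I) / 2) (t := (1 - ω * Complex.I) / 2) (by simp) (by simp)
  have hsum : (1 + ω * Complex.I) / 2 + (1 - ω * Complex.I) / 2 = 1 := by ring
  have hsub : (1 - ω * Complex.I) / 2 = 1 - (1 + ω * Complex.I) / 2 := by ring
  have hsin : Complex.sin (Real.pi * ((1 + ω * Complex.I) / 2)) =
      (Real.cosh (Real.pi * ω / 2) : ℝ) := by
    have harg : (Real.pi : ℂ) * ((1 + ω * Complex.I) / 2) =
        (Real.pi * ω / 2 : ℝ) * Complex.I + Real.pi / 2 := by
      push_cast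
      ring
    rw [harg, Complex.sin_add_pi_div_two, Complex.cos_mul_I, Complex.ofReal_cosh]
  rw [hsum, Complex.Gamma_one, one_mul, hsubst] at hbeta
  rw [← hbeta, hsub, Complex.Gamma_mul_Gamma_one_sub, hsin]
  push_cast
  rw [div_eq_mul_inv]

theorem integral_inv_cosh_mul_sin (ω θ : ℝ) :
    ∫ t : ℝ, (Real.cosh t)⁻¹ * Real.sin (ω * t + θ) =
      Real.pi * (Real.cosh (Real.pi * ω / 2))⁻¹ * Real.sin θ := by
  have hint : Integrable fun t : ℝ =>
      (((Real.cosh t)⁻¹ : ℝ) : ℂ) * Complex.exp ((ω * t : ℝ) * Complex.I) *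
        Complex.exp (θ * Complex.I) := by
    refine (integrable_inv_cosh.ofReal.mul_bdd (c := 1)
      (Continuous.aestronglyMeasurable (by fun_prop))
      (Eventually.of_forall fun t => ?_)).mul_const _
    exact (Complex.norm_exp_ofReal_mul_I _).le
  have him := integral_im hint
  rw [integral_mul_const, integral_inv_cosh_mul_cexp] at him
  simp only [RCLike.im_to_complex, Complex.im_ofReal_mul, Complex.exp_ofReal_mul_I_im,
    mul_assoc, ← Complex.exp_add, ← add_mul, ← Complex.ofReal_add] at him
  rw [him, mul_assoc]

theorem hasDerivAt_inv_cosh (t : ℝ) :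
    HasDerivAt (fun s => (Real.cosh s)⁻¹) (-((Real.cosh t)⁻¹ * Real.tanh t)) t := by
  refine ((Real.hasDerivAt_cosh t).inv (Real.cosh_pos t).ne').congr_deriv ?_
  rw [Real.tanh_eq_sinh_div_cosh]
  field_simp

theorem hasDerivAt_tanh (t : ℝ) : HasDerivAt Real.tanh ((Real.cosh t)⁻¹ ^ 2) t := by
  have hcosh := (Real.cosh_pos t).ne'
  rw [show Real.tanh = Real.sinh / Real.cosh from funext Real.tanh_eq_sinh_div_cosh]
  refine ((Real.hasDerivAt_sinh t).div (Real.hasDerivAt_cosh t) hcosh).congr_deriv ?_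
  field_simp
  linarith [Real.cosh_sq t]

theorem continuous_real_tanh : Continuous Real.tanh :=
  continuous_iff_continuousAt.2 fun t => (hasDerivAt_tanh t).continuousAt

theorem tanh_eq_two_mul_sigmoid_sub_one (t : ℝ) :
    Real.tanh t = 2 * Real.sigmoid (2 * t) - 1 := by
  have h := one_sub_sigmoid_two_mul_mul_exp t
  have h' : 1 - Real.sigmoid (2 * t) = (2 * Real.cosh t)⁻¹ * Real.exp (-t) := by
    rw [← h, mul_assoc, ← Real.exp_add, add_neg_cancel, Real.exp_zero, mul_one]
  rw [Real.tanh_eq_sinh_div_cosh,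
    show 2 * Real.sigmoid (2 * t) - 1 = 1 - 2 * (1 - Real.sigmoid (2 * t)) by ring, h',
    ← Real.cosh_sub_sinh]
  have hcosh := (Real.cosh_pos t).ne'
  field_simp
  ring

theorem abs_real_tanh_le_one (t : ℝ) : |Real.tanh t| ≤ 1 := by
  rw [tanh_eq_two_mul_sigmoid_sub_one, abs_le]
  constructor <;> linarith [Real.sigmoid_pos (2 * t), Real.sigmoid_lt_one (2 * t)]

theorem tendsto_real_tanh_atTop : Tendsto Real.tanh atTop (𝓝 1) := by
  have h := ((Real.tendsto_sigmoid_atTop.comp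
    (tendsto_id.const_mul_atTop (two_pos (α := ℝ)))).const_mul 2).sub_const 1
  norm_num at h
  exact h.congr fun t => (tanh_eq_two_mul_sigmoid_sub_one t).symm

theorem tendsto_real_tanh_atBot : Tendsto Real.tanh atBot (𝓝 (-1)) := by
  have h := (tendsto_real_tanh_atTop.comp tendsto_neg_atBot_atTop).neg
  exact h.congr fun t => by simp

theorem integrable_inv_cosh_mul_tanh_sq :
    Integrable fun t : ℝ => ((Real.cosh t)⁻¹ * Real.tanh t) ^ 2 := by
  have hbound : ∀ t, |(Real.cosh t)⁻¹ * Real.tanh t ^ 2| ≤ 1 := fun t => by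
    rw [abs_mul, abs_pow, abs_of_pos (inv_pos.2 (Real.cosh_pos t))]
    exact mul_le_one₀ (inv_le_one_of_one_le₀ (Real.one_le_cosh t)) (by positivity)
      (pow_le_one₀ (abs_nonneg _) (abs_real_tanh_le_one t))
  refine (integrable_inv_cosh_mul (continuous_inv_cosh.mul (continuous_real_tanh.pow 2))
    hbound).congr (Eventually.of_forall fun t => ?_)
  simp only [Pi.mul_apply, Pi.pow_apply]
  ring

theorem integral_inv_cosh_mul_tanh_sq :
    ∫ t : ℝ, ((Real.cosh t)⁻¹ * Real.tanh t) ^ 2 = 2 / 3 := by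
  have hderiv : ∀ t : ℝ, HasDerivAt (fun s => Real.tanh s ^ 3 / 3)
      (((Real.cosh t)⁻¹ * Real.tanh t) ^ 2) t := fun t => by
    refine (((hasDerivAt_tanh t).pow 3).div_const 3).congr_deriv ?_
    push_cast
    ring
  rw [integral_of_hasDerivAt_of_tendsto hderiv integrable_inv_cosh_mul_tanh_sq
    ((tendsto_real_tanh_atBot.pow 3).div_const 3) ((tendsto_real_tanh_atTop.pow 3).div_const 3)]
  norm_num

theorem integrable_inv_cosh_mul_tanh_mul_cos (ω θ : ℝ) :
    Integrable fun t : ℝ => (Real.cosh t)⁻¹ * (Real.tanh t * Real.cos (ω * t + θ)) := by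
  refine integrable_inv_cosh_mul (C := 1) (continuous_real_tanh.mul (by fun_prop)) fun t => ?_
  rw [abs_mul]
  exact mul_le_one₀ (abs_real_tanh_le_one t) (abs_nonneg _) (Real.abs_cos_le_one _)

theorem integral_inv_cosh_mul_tanh_mul_cos (ω θ : ℝ) :
    ∫ t : ℝ, (Real.cosh t)⁻¹ * (Real.tanh t * Real.cos (ω * t + θ)) =
      -(Real.pi * ω * (Real.cosh (Real.pi * ω / 2))⁻¹ * Real.sin θ) := by
  have hcos : Integrable fun t : ℝ => (Real.cosh t)⁻¹ * Real.cos (ω * t + θ) :=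
    integrable_inv_cosh_mul (by fun_prop) fun t => Real.abs_cos_le_one _
  have hsin : Integrable fun t : ℝ => (Real.cosh t)⁻¹ * Real.sin (ω * t + θ) :=
    integrable_inv_cosh_mul (by fun_prop) fun t => Real.abs_sin_le_one _
  have htanh := integrable_inv_cosh_mul_tanh_mul_cos ω θ
  have hderiv : ∀ t : ℝ, HasDerivAt (fun s => (Real.cosh s)⁻¹ * Real.cos (ω * s + θ))
      (-((Real.cosh t)⁻¹ * (Real.tanh t * Real.cos (ω * t + θ))) -
        ω * ((Real.cosh t)⁻¹ * Real.sin (ω * t + θ))) t := fun t => by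
    have harg : HasDerivAt (fun s : ℝ => ω * s + θ) ω t := by
      simpa using ((hasDerivAt_id t).const_mul ω).add_const θ
    refine ((hasDerivAt_inv_cosh t).mul harg.cos).congr_deriv ?_
    ring
  have hzero := integral_eq_zero_of_hasDerivAt_of_integrable hderiv
    (htanh.neg.sub (hsin.const_mul ω)) hcos
  rw [integral_sub htanh.fun_neg (hsin.const_mul ω), integral_neg, integral_const_mul,
    integral_inv_cosh_mul_sin] at hzero
  linarith

/-- The Melnikov function of the periodically forced Duffing oscillator
`ẋ₁ = x₂, ẋ₂ = x₁ − x₁³ + ε(β cos ωt − δx₂)` along the homoclinic orbit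
`x^h(t) = (√2 sech t, −√2 sech t tanh t)`, namely
`M(θ) = ∫ x₂^h(t) (β cos(ωt+θ) − δ x₂^h(t)) dt`, equals
`√2 π β ω sech(πω/2) sin θ − 4δ/3`; in particular, if `β ≠ 0` then `M` is not
a constant function of `θ`. -/
theorem melnikov_duffing_homoclinic (β ω δ : ℝ) (hβpos : 0 < β) (hω : 0 < ω)
    (hδ : 0 ≤ δ)
    (x2h : ℝ → ℝ) (hx2h : ∀ t, x2h t = -(Real.sqrt 2 * (Real.cosh t)⁻¹ * Real.tanh t))
    (M : ℝ → ℝ)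
    (hM : ∀ θ, M θ = ∫ t : ℝ, x2h t * (β * Real.cos (ω * t + θ) - δ * x2h t)) :
    (∀ θ : ℝ, M θ
      = Real.sqrt 2 * Real.pi * β * ω * (Real.cosh (Real.pi * ω / 2))⁻¹ * Real.sin θ
        - 4 * δ / 3) ∧
    (β ≠ 0 → ∃ θ₁ θ₂ : ℝ, M θ₁ ≠ M θ₂) := by
  have hformula : ∀ θ : ℝ, M θ
      = Real.sqrt 2 * Real.pi * β * ω * (Real.cosh (Real.pi * ω / 2))⁻¹ * Real.sin θ
        - 4 * δ / 3 := fun θ => by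
    have hintegrand : ∀ t : ℝ, x2h t * (β * Real.cos (ω * t + θ) - δ * x2h t) =
        -(Real.sqrt 2 * β) * ((Real.cosh t)⁻¹ * (Real.tanh t * Real.cos (ω * t + θ))) -
          2 * δ * ((Real.cosh t)⁻¹ * Real.tanh t) ^ 2 := fun t => by
      rw [hx2h]
      linear_combination
        (-δ * ((Real.cosh t)⁻¹ * Real.tanh t) ^ 2) * Real.sq_sqrt (zero_le_two (α := ℝ))
    simp_rw [hM, hintegrand]
    rw [integral_sub ((integrable_inv_cosh_mul_tanh_mul_cos ω θ).const_mul _)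
      (integrable_inv_cosh_mul_tanh_sq.const_mul _), integral_const_mul, integral_const_mul,
      integral_inv_cosh_mul_tanh_mul_cos, integral_inv_cosh_mul_tanh_sq]
    ring
  refine ⟨hformula, fun _ => ⟨Real.pi / 2, 0, ?_⟩⟩
  have hamplitude : 0 < Real.sqrt 2 * Real.pi * β * ω * (Real.cosh (Real.pi * ω / 2))⁻¹ := by
    have := Real.cosh_pos (Real.pi * ω / 2)
    positivity
  rw [hformula, hformula, Real.sin_pi_div_two, Real.sin_zero]
  linarith
end

section
/- For all θ ∈ ℝ, M(θ) = √2 π ω β cosech(πω/√2) cos θ − 2√2 δ/3. In particular, if β ≠ 0 then M is not a constant function of θ. -/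
open MeasureTheory

namespace Real

theorem integrable_and_integral_sigmoid_cpow {a b : ℂ} (ha : 0 < a.re) (hb : 0 < b.re) :
    Integrable (fun u : ℝ => (sigmoid u : ℂ) ^ a * ((1 : ℂ) - sigmoid u) ^ b) ∧
      ∫ u : ℝ, (sigmoid u : ℂ) ^ a * ((1 : ℂ) - sigmoid u) ^ b = Complex.betaIntegral a b := by
  have hderiv : ∀ u ∈ Set.univ, HasDerivWithinAt sigmoid (sigmoid u * (1 - sigmoid u)) Set.univ u :=
    fun u _ => (hasDerivAt_sigmoid u).hasDerivWithinAt
  have hinj : Set.InjOn sigmoid Set.univ := sigmoid_strictMono.injective.injOn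
  have himage : sigmoid '' Set.univ = Set.Ioo 0 1 := by rw [Set.image_univ, range_sigmoid]
  have hpt : ∀ u : ℝ, |sigmoid u * (1 - sigmoid u)| •
      ((sigmoid u : ℂ) ^ (a - 1) * ((1 : ℂ) - sigmoid u) ^ (b - 1)) =
      (sigmoid u : ℂ) ^ a * ((1 : ℂ) - sigmoid u) ^ b := by
    intro u
    have h0 := sigmoid_pos u
    have h1 : 0 < 1 - sigmoid u := sub_pos.2 (sigmoid_lt_one u)
    have h0c : (sigmoid u : ℂ) ≠ 0 := by exact_mod_cast h0.ne'
    have h1c : (1 : ℂ) - sigmoid u ≠ 0 := by exact_mod_cast h1.ne'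
    rw [abs_of_pos (mul_pos h0 h1), Complex.cpow_sub _ _ h0c, Complex.cpow_sub _ _ h1c,
      Complex.cpow_one, Complex.cpow_one, Complex.real_smul]
    push_cast
    field_simp
  have hint := integrableOn_image_iff_integrableOn_abs_deriv_smul MeasurableSet.univ hderiv hinj
    (fun x : ℝ => (x : ℂ) ^ (a - 1) * ((1 : ℂ) - x) ^ (b - 1))
  have hval := integral_image_eq_integral_abs_deriv_smul MeasurableSet.univ hderiv hinj
    (fun x : ℝ => (x : ℂ) ^ (a - 1) * ((1 : ℂ) - x) ^ (b - 1))
  simp only [hpt, himage, integrableOn_univ, setIntegral_univ] at hint hval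
  refine ⟨hint.1 ?_, ?_⟩
  · exact ((intervalIntegrable_iff_integrableOn_Ioo_of_le zero_le_one).1
      (Complex.betaIntegral_convergent ha hb))
  · rw [← hval, Complex.betaIntegral, intervalIntegral.integral_of_le zero_le_one,
      integral_Ioc_eq_integral_Ioo]

theorem one_sub_sigmoid (u : ℝ) : 1 - sigmoid u = sigmoid u * exp (-u) := by
  rw [sigmoid_mul_rexp_neg, sigmoid_neg]

theorem inv_cosh_sq_eq_sigmoid (s : ℝ) :
    (cosh s)⁻¹ ^ 2 = 4 * (sigmoid (2 * s) * (1 - sigmoid (2 * s))) := by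
  rw [one_sub_sigmoid, sigmoid_def, cosh_eq, show -(2 * s) = -s + -s by ring, exp_add, exp_neg]
  have := exp_pos s
  have : 1 + (exp s)⁻¹ * (exp s)⁻¹ ≠ 0 := by positivity
  field_simp
  ring

theorem sigmoid_cpow_mul_one_sub_sigmoid_cpow (u : ℝ) (z : ℂ) :
    (sigmoid u : ℂ) ^ (1 + z) * ((1 : ℂ) - sigmoid u) ^ (1 - z) =
      (sigmoid u * (1 - sigmoid u) : ℝ) * Complex.exp (z * u) := by
  have h0 := sigmoid_pos u
  have h1 : 0 < 1 - sigmoid u := sub_pos.2 (sigmoid_lt_one u)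
  have h0c : (sigmoid u : ℂ) ≠ 0 := by exact_mod_cast h0.ne'
  have h1c : (1 : ℂ) - sigmoid u ≠ 0 := by exact_mod_cast h1.ne'
  have hlog : log (1 - sigmoid u) = log (sigmoid u) - u := by
    rw [one_sub_sigmoid, log_mul h0.ne' (exp_pos _).ne', log_exp, sub_eq_add_neg]
  have hlogc : Complex.log (1 - sigmoid u) = Complex.log (sigmoid u) - u := by
    have := congrArg (fun x : ℝ => (x : ℂ)) hlog
    simpa [Complex.ofReal_log h1.le, Complex.ofReal_log h0.le] using this
  rw [Complex.cpow_add _ _ h0c, Complex.cpow_sub _ _ h1c, Complex.cpow_one, Complex.cpow_one,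
    Complex.cpow_def_of_ne_zero h0c, Complex.cpow_def_of_ne_zero h1c, hlogc, div_eq_mul_inv,
    ← Complex.exp_neg, show z * (u : ℂ) = Complex.log (sigmoid u) * z +
      -((Complex.log (sigmoid u) - u) * z) by ring, Complex.exp_add]
  push_cast
  ring

theorem betaIntegral_one_add_mul_I_one_sub_mul_I {a : ℝ} (ha : a ≠ 0) :
    Complex.betaIntegral (1 + a * Complex.I) (1 - a * Complex.I) =
      (π * a / sinh (π * a) : ℝ) := by
  have hz : (a : ℂ) * Complex.I ≠ 0 := by simp [ha]
  rw [Complex.betaIntegral_eq_Gamma_mul_div _ _ (by simp) (by simp), add_comm 1,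
    Complex.Gamma_add_one _ hz, mul_assoc, Complex.Gamma_mul_Gamma_one_sub,
    show (a : ℂ) * Complex.I + 1 + (1 - a * Complex.I) = 1 + 1 by ring,
    Complex.Gamma_add_one _ one_ne_zero, Complex.Gamma_one, ← mul_assoc, Complex.sin_mul_I]
  have hs : Complex.sinh (π * a) ≠ 0 := by
    have : sinh (π * a) ≠ 0 := by simp [sinh_eq_zero, ha, pi_ne_zero]
    exact_mod_cast this
  push_cast
  field_simp

theorem integrable_and_integral_sigmoid_mul_cos {w : ℝ} (hw : w ≠ 0) (θ : ℝ) :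
    Integrable (fun u : ℝ => sigmoid u * (1 - sigmoid u) * cos (w * u + θ)) ∧
      ∫ u : ℝ, sigmoid u * (1 - sigmoid u) * cos (w * u + θ) =
        π * w / sinh (π * w) * cos θ := by
  obtain ⟨hint, hval⟩ := integrable_and_integral_sigmoid_cpow
    (a := 1 + w * Complex.I) (b := 1 - w * Complex.I) (by simp) (by simp)
  rw [betaIntegral_one_add_mul_I_one_sub_mul_I hw] at hval
  simp only [sigmoid_cpow_mul_one_sub_sigmoid_cpow] at hint hval
  have hre : ∀ u : ℝ, RCLike.re (Complex.exp (θ * Complex.I) *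
      ((sigmoid u * (1 - sigmoid u) : ℝ) * Complex.exp (w * Complex.I * u))) =
      sigmoid u * (1 - sigmoid u) * cos (w * u + θ) := by
    intro u
    rw [mul_left_comm, ← Complex.exp_add,
      show (θ : ℂ) * Complex.I + w * Complex.I * u = ((w * u + θ : ℝ) : ℂ) * Complex.I by
        push_cast; ring, RCLike.re_to_complex, Complex.re_ofReal_mul, Complex.exp_ofReal_mul_I_re]
  have hint' := hint.const_mul (Complex.exp (θ * Complex.I))
  have hval' := integral_re hint'
  have hintre := hint'.re
  simp only [hre] at hval' hintre
  refine ⟨hintre, ?_⟩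
  rw [hval', integral_const_mul, hval, mul_comm, RCLike.re_to_complex, Complex.re_ofReal_mul,
    Complex.exp_ofReal_mul_I_re]

theorem integrable_and_integral_sigmoid_mul_one_sub_sq :
    Integrable (fun u : ℝ => (sigmoid u * (1 - sigmoid u)) ^ 2) ∧
      ∫ u : ℝ, (sigmoid u * (1 - sigmoid u)) ^ 2 = 1 / 6 := by
  obtain ⟨hint, hval⟩ := integrable_and_integral_sigmoid_cpow
    (a := 2) (b := 2) (by simp) (by simp)
  have hpt : ∀ u : ℝ, (sigmoid u : ℂ) ^ (2 : ℂ) * ((1 : ℂ) - sigmoid u) ^ (2 : ℂ) =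
      (((sigmoid u * (1 - sigmoid u)) ^ 2 : ℝ) : ℂ) := by
    intro u
    simp [mul_pow]
  have hbeta : Complex.betaIntegral 2 2 = ((1 / 6 : ℝ) : ℂ) := by
    have h2 : Complex.Gamma 2 = 1 := by simp
    have h4 : Complex.Gamma 4 = 6 := by norm_num [Nat.factorial]
    rw [Complex.betaIntegral_eq_Gamma_mul_div _ _ (by simp) (by simp), h2,
      show (2 : ℂ) + 2 = 4 by norm_num, h4]
    norm_num
  simp only [hpt, hbeta] at hint hval
  rw [integral_complex_ofReal] at hval
  exact ⟨hint.re, by exact_mod_cast hval⟩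

end Real

/-- The Melnikov function of the periodically forced Duffing oscillator
`ẋ₁ = x₂, ẋ₂ = −x₁ + x₁³ + ε(β cos ωt − δx₂)` along the heteroclinic orbit
`x^h(t) = (tanh(t/√2), sech²(t/√2)/√2)`, namely
`M(θ) = ∫ x₂^h(t) (β cos(ωt+θ) − δ x₂^h(t)) dt`, equals
`√2 π ω β cosech(πω/√2) cos θ − 2√2 δ/3`; in particular, if `β ≠ 0` then `M` is
not a constant function of `θ`. -/
theorem melnikov_duffing_heteroclinic (β ω δ : ℝ) (hβpos : 0 < β) (hω : 0 < ω)
    (hδ : 0 ≤ δ)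
    (x2h : ℝ → ℝ)
    (hx2h : ∀ t, x2h t = ((Real.cosh (t / Real.sqrt 2))⁻¹) ^ 2 / Real.sqrt 2)
    (M : ℝ → ℝ)
    (hM : ∀ θ, M θ = ∫ t : ℝ, x2h t * (β * Real.cos (ω * t + θ) - δ * x2h t)) :
    (∀ θ : ℝ, M θ
      = Real.sqrt 2 * Real.pi * ω * β * (Real.sinh (Real.pi * ω / Real.sqrt 2))⁻¹
          * Real.cos θ
        - 2 * Real.sqrt 2 * δ / 3) ∧
    (β ≠ 0 → ∃ θ₁ θ₂ : ℝ, M θ₁ ≠ M θ₂) := by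
  have h2 : (0 : ℝ) < Real.sqrt 2 := by positivity
  have hsq : Real.sqrt 2 ^ 2 = 2 := Real.sq_sqrt zero_le_two
  have hw : 0 < ω / Real.sqrt 2 := div_pos hω h2
  have hx : ∀ t, x2h t = 4 / Real.sqrt 2 *
      (Real.sigmoid (Real.sqrt 2 * t) * (1 - Real.sigmoid (Real.sqrt 2 * t))) := by
    intro t
    have harg : 2 * (t / Real.sqrt 2) = Real.sqrt 2 * t := by
      field_simp
      rw [hsq, mul_comm]
    rw [hx2h, Real.inv_cosh_sq_eq_sigmoid, harg]
    ring
  obtain ⟨hSint, hSval⟩ := Real.integrable_and_integral_sigmoid_mul_one_sub_sq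
  have hformula : ∀ θ : ℝ, M θ
      = Real.sqrt 2 * Real.pi * ω * β * (Real.sinh (Real.pi * ω / Real.sqrt 2))⁻¹
          * Real.cos θ
        - 2 * Real.sqrt 2 * δ / 3 := by
    intro θ
    obtain ⟨hCint, hCval⟩ := Real.integrable_and_integral_sigmoid_mul_cos hw.ne' θ
    have hscale := Measure.integral_comp_mul_left (fun u : ℝ => 4 / Real.sqrt 2 * β *
        (Real.sigmoid u * (1 - Real.sigmoid u) * Real.cos (ω / Real.sqrt 2 * u + θ)) -
      (4 / Real.sqrt 2) ^ 2 * δ * (Real.sigmoid u * (1 - Real.sigmoid u)) ^ 2) (Real.sqrt 2)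
    rw [integral_sub (hCint.const_mul _) (hSint.const_mul _), integral_const_mul,
      integral_const_mul, hCval, hSval, abs_of_pos (inv_pos.2 h2), smul_eq_mul,
      ← mul_div_assoc] at hscale
    have hpt : ∀ t, x2h t * (β * Real.cos (ω * t + θ) - δ * x2h t) =
        4 / Real.sqrt 2 * β * (Real.sigmoid (Real.sqrt 2 * t) *
            (1 - Real.sigmoid (Real.sqrt 2 * t)) *
            Real.cos (ω / Real.sqrt 2 * (Real.sqrt 2 * t) + θ)) -
          (4 / Real.sqrt 2) ^ 2 * δ * (Real.sigmoid (Real.sqrt 2 * t) *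
            (1 - Real.sigmoid (Real.sqrt 2 * t))) ^ 2 := by
      intro t
      have harg : ω / Real.sqrt 2 * (Real.sqrt 2 * t) = ω * t := by field_simp
      rw [hx, harg]
      ring
    rw [hM, integral_congr_ae (Filter.Eventually.of_forall hpt), hscale]
    have hs : Real.sinh (Real.pi * ω / Real.sqrt 2) ≠ 0 :=
      (Real.sinh_pos_iff.2 (by positivity)).ne'
    field_simp
    rw [show Real.sqrt 2 ^ 4 = (Real.sqrt 2 ^ 2) ^ 2 by ring, hsq]
    ring
  refine ⟨hformula, fun _ => ⟨0, Real.pi, ?_⟩⟩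
  have hs : 0 < Real.sinh (Real.pi * ω / Real.sqrt 2) :=
    Real.sinh_pos_iff.2 (by positivity)
  have hamp : 0 < Real.sqrt 2 * Real.pi * ω * β *
      (Real.sinh (Real.pi * ω / Real.sqrt 2))⁻¹ := by positivity
  rw [hformula, hformula, Real.cos_zero, Real.cos_pi]
  intro h
  linarith
end
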